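/- arXiv:1907.10050 — 2 statements merged into one kernel-verified Lean document; each statement's English description precedes it below -/
import Mathlib

section
/- Let X be a random vector in ℝ^d with E|X_i| < ∞ for every coordinate i ∈ {1,…,d}, and let ν be a Lévy measure on ℝ^d with ∫_{‖u‖≥1} ‖u‖ ν(du) < ∞. Then the identity E[X f(X)] = E[X] E[f(X)] + E[∫_{ℝ^d} (f(X+u) − f(X)) u ν(du)] (an equality of vectors in ℝ^d) holds for every bounded Lipschitz function f : ℝ^d → ℝ if and only if the characteristic function of X equals φ(ξ) = exp( i⟨E[X], ξ⟩ + ∫_{ℝ^d} (e^{i⟨u,ξ⟩} − 1 − i⟨u,ξ⟩) ν(du) ) for all ξ ∈ ℝ^d, i.e., X is infinitely divisible with Lévy measure ν, no Gaussian component, and center E[X]. -/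
open MeasureTheory ProbabilityTheory Filter Set
open scoped RealInnerProductSpace ENNReal NNReal Topology

noncomputable section

/-- A Lévy measure on `ℝ^d`: a Borel measure with no atom at the origin and
integrating `min(1, ‖u‖²)`. -/
def IsLevyMeasure {d : ℕ} (ν : Measure (EuclideanSpace ℝ (Fin d))) : Prop :=
  ν {0} = 0 ∧ ∫⁻ u, ENNReal.ofReal (min 1 (‖u‖ ^ 2)) ∂ν < ⊤

/-- The characteristic function of a measure on `ℝ^d`. -/
def charFn {d : ℕ} (μ : Measure (EuclideanSpace ℝ (Fin d)))
    (ξ : EuclideanSpace ℝ (Fin d)) : ℂ :=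
  ∫ x, Complex.exp (Complex.I * (⟪ξ, x⟫ : ℂ)) ∂μ

variable {E : Type*} [NormedAddCommGroup E]

/-- The function `f` is both bounded by `K` and `K`-Lipschitz. -/
def IsBoundedLipschitz (K : ℝ≥0) (f : E → ℂ) : Prop :=
  LipschitzWith K f ∧ ∀ x, ‖f x‖ ≤ K

/-- The weight `min(1, ‖u‖) ‖u‖`, which dominates the increments `(f(x+u) - f(x)) u` of bounded
Lipschitz functions. -/
def levyWeight (u : E) : ℝ := min 1 ‖u‖ * ‖u‖

lemma levyWeight_nonneg (u : E) : 0 ≤ levyWeight u := by unfold levyWeight; positivity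

lemma IsBoundedLipschitz.norm_sub_le {K : ℝ≥0} {f : E → ℂ} (hf : IsBoundedLipschitz K f)
    (x u : E) : ‖f (x + u) - f x‖ ≤ 2 * K * min 1 ‖u‖ := by
  have h1 : ‖f (x + u) - f x‖ ≤ K * ‖u‖ := by
    simpa [dist_eq_norm] using hf.1.dist_le_mul (x + u) x
  have h2 : ‖f (x + u) - f x‖ ≤ 2 * K := by
    linarith [_root_.norm_sub_le (f (x + u)) (f x), hf.2 (x + u), hf.2 x]
  rcases min_cases 1 ‖u‖ with ⟨h, -⟩ | ⟨h, -⟩ <;> rw [h]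
  · linarith
  · nlinarith [norm_nonneg u, K.2, mul_nonneg K.2 (norm_nonneg u)]

/-- A radial cutoff: `1` on the ball of radius `r - 1`, and `0` outside the ball of radius `r`. -/
def radialCutoff (r : ℝ) (x : E) : ℝ := max 0 (min 1 (r - ‖x‖))

lemma radialCutoff_nonneg (r : ℝ) (x : E) : 0 ≤ radialCutoff r x := le_max_left _ _

lemma radialCutoff_le_one (r : ℝ) (x : E) : radialCutoff r x ≤ 1 :=
  max_le zero_le_one (min_le_left _ _)

lemma lipschitzWith_radialCutoff (r : ℝ) : LipschitzWith 1 (radialCutoff (E := E) r) := by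
  have h : LipschitzWith 1 fun x : E => r - ‖x‖ :=
    LipschitzWith.of_dist_le_mul fun x y => by
      simpa [Real.dist_eq, dist_eq_norm, abs_sub_comm] using abs_norm_sub_norm_le x y
  exact (h.const_min 1).const_max 0

lemma IsBoundedLipschitz.radialCutoff_mul {K : ℝ≥0} {f : E → ℂ} (hf : IsBoundedLipschitz K f)
    (r : ℝ) : IsBoundedLipschitz (2 * K) fun x => (radialCutoff r x : ℂ) * f x := by
  have hn : ∀ x : E, ‖(radialCutoff r x : ℂ)‖ ≤ 1 := fun x => by
    rw [Complex.norm_real, Real.norm_of_nonneg (radialCutoff_nonneg r x)]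
    exact radialCutoff_le_one r x
  refine ⟨LipschitzWith.of_dist_le_mul fun x y => ?_, fun x => ?_⟩
  · have h1 : (radialCutoff r x : ℂ) * f x - (radialCutoff r y : ℂ) * f y
        = (radialCutoff r x : ℂ) * (f x - f y)
          + ((radialCutoff r x - radialCutoff r y : ℝ) : ℂ) * f y := by push_cast; ring
    have h2 := hf.1.dist_le_mul x y
    have h3 := (lipschitzWith_radialCutoff (E := E) r).dist_le_mul x y
    rw [dist_eq_norm, h1]
    refine (norm_add_le _ _).trans ?_
    rw [norm_mul, norm_mul, Complex.norm_real (_ - _), ← dist_eq_norm, ← dist_eq_norm]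
    calc _ ≤ 1 * (K * dist x y) + (((1 : ℝ≥0) : ℝ) * dist x y) * K := by
          gcongr
          · exact hn x
          · exact hf.2 y
      _ = _ := by push_cast; ring
  · rw [norm_mul]
    calc _ ≤ 1 * (K : ℝ) := by gcongr; exacts [hn x, hf.2 x]
      _ ≤ _ := by push_cast; linarith [K.2]

lemma norm_exp_I_mul_sub_one_sub_le (y : ℝ) :
    ‖Complex.exp (Complex.I * y) - 1 - Complex.I * y‖ ≤ 2 * (min 1 |y| * |y|) := by
  have hn : ‖Complex.I * (y : ℂ)‖ = |y| := by simp
  rcases le_total |y| 1 with hy | hy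
  · have := Complex.norm_exp_sub_one_sub_id_le (hn.trans_le hy)
    rw [hn] at this
    rw [min_eq_right hy]
    nlinarith [abs_nonneg y]
  · rw [min_eq_left hy]
    refine (norm_sub_le _ _).trans ?_
    have h1 : ‖Complex.exp (Complex.I * y) - 1‖ ≤ |y| := Real.norm_exp_I_mul_ofReal_sub_one_le
    linarith

lemma IsBoundedLipschitz.re {K : ℝ≥0} {f : E → ℂ} (hf : IsBoundedLipschitz K f) :
    IsBoundedLipschitz K fun x => ((f x).re : ℂ) := by
  refine ⟨LipschitzWith.of_dist_le_mul fun x y => ?_, fun x => ?_⟩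
  · refine le_trans ?_ (hf.1.dist_le_mul x y)
    rw [dist_eq_norm, dist_eq_norm, ← Complex.ofReal_sub, ← Complex.sub_re, Complex.norm_real]
    exact Complex.abs_re_le_norm _
  · rw [Complex.norm_real]
    exact (Complex.abs_re_le_norm _).trans (hf.2 x)

lemma IsBoundedLipschitz.im {K : ℝ≥0} {f : E → ℂ} (hf : IsBoundedLipschitz K f) :
    IsBoundedLipschitz K fun x => ((f x).im : ℂ) := by
  refine ⟨LipschitzWith.of_dist_le_mul fun x y => ?_, fun x => ?_⟩
  · refine le_trans ?_ (hf.1.dist_le_mul x y)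
    rw [dist_eq_norm, dist_eq_norm, ← Complex.ofReal_sub, ← Complex.sub_im, Complex.norm_real]
    exact Complex.abs_im_le_norm _
  · rw [Complex.norm_real]
    exact (Complex.abs_im_le_norm _).trans (hf.2 x)

section NormedMeasure

variable [MeasurableSpace E] [BorelSpace E]

lemma IsBoundedLipschitz.integrable {μ : Measure E} [IsProbabilityMeasure μ] {K : ℝ≥0}
    {f : E → ℂ} (hf : IsBoundedLipschitz K f) : Integrable f μ :=
  .of_bound hf.1.continuous.aestronglyMeasurable K (.of_forall hf.2)

lemma integrable_levyWeight {ν : Measure E}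
    (h0 : ∫⁻ u, ENNReal.ofReal (min 1 (‖u‖ ^ 2)) ∂ν < ⊤)
    (h1 : ∫⁻ u in {u : E | 1 ≤ ‖u‖}, ENNReal.ofReal ‖u‖ ∂ν < ⊤) : Integrable levyWeight ν := by
  have hm : MeasurableSet {u : E | 1 ≤ ‖u‖} := measurableSet_le measurable_const measurable_norm
  have hc : Continuous (levyWeight (E := E)) := by unfold levyWeight; fun_prop
  refine ⟨hc.aestronglyMeasurable, ?_⟩
  rw [hasFiniteIntegral_iff_ofReal (.of_forall levyWeight_nonneg)]
  rw [← lintegral_indicator hm] at h1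
  refine lt_of_le_of_lt (lintegral_mono fun u => ?_)
    ((lintegral_add_left (by fun_prop) _).trans_lt (ENNReal.add_lt_top.2 ⟨h0, h1⟩))
  rcases le_total 1 ‖u‖ with h | h
  · refine le_trans ?_ le_add_self
    rw [indicator_of_mem (show u ∈ {u : E | 1 ≤ ‖u‖} from h), levyWeight, min_eq_left h, one_mul]
  · refine le_trans (ENNReal.ofReal_le_ofReal ?_) le_self_add
    rw [levyWeight, min_eq_right h, min_eq_right (by nlinarith [norm_nonneg u]), sq]

lemma sFinite_of_integrable_levyWeight {ν : Measure E} (h0 : ν {0} = 0)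
    (hν : Integrable levyWeight ν) : SFinite ν := by
  have hc : Continuous (levyWeight (E := E)) := by unfold levyWeight; fun_prop
  have hfin : IsFiniteMeasure (ν.withDensity fun u => ENNReal.ofReal (levyWeight u)) :=
    isFiniteMeasure_withDensity_ofReal hν.2
  rw [← withDensity_inv_same (μ := ν) (f := fun u => ENNReal.ofReal (levyWeight u))
    (by fun_prop) ?_ (.of_forall fun u => ENNReal.ofReal_ne_top)]
  · infer_instance
  · have h : ∀ᵐ u ∂ν, u ≠ 0 := by simpa [ae_iff] using h0
    filter_upwards [h] with u hu
    have := norm_pos_iff.2 hu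
    rw [levyWeight]
    exact (ENNReal.ofReal_pos.2 (by positivity)).ne'

end NormedMeasure

variable [InnerProductSpace ℝ E]

/-- The jump integrand `(f(x+u) - f(x)) ⟪η, u⟫`, as a function of the pair `(x, u)`. -/
def jumpIncrement (f : E → ℂ) (η : E) (p : E × E) : ℂ :=
  (f (p.1 + p.2) - f p.1) * ((⟪η, p.2⟫ : ℝ) : ℂ)

/-- The character `x ↦ exp(i⟪ξ, x⟫)`. -/
def expInner (ξ x : E) : ℂ := Complex.exp (Complex.I * ((⟪ξ, x⟫ : ℝ) : ℂ))

lemma IsBoundedLipschitz.norm_jumpIncrement_le {K : ℝ≥0} {f : E → ℂ}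
    (hf : IsBoundedLipschitz K f) (η : E) (p : E × E) :
    ‖jumpIncrement f η p‖ ≤ 2 * K * ‖η‖ * levyWeight p.2 := by
  rw [jumpIncrement, norm_mul, Complex.norm_real]
  calc _ ≤ (2 * K * min 1 ‖p.2‖) * (‖η‖ * ‖p.2‖) := by
        gcongr
        · exact hf.norm_sub_le _ _
        · exact norm_inner_le_norm _ _
    _ = _ := by rw [levyWeight]; ring

lemma continuous_jumpIncrement {f : E → ℂ} (hf : Continuous f) (η : E) :
    Continuous (jumpIncrement f η) := by
  unfold jumpIncrement; fun_prop

lemma continuous_expInner : Continuous fun p : E × E => expInner p.1 p.2 := by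
  unfold expInner; fun_prop

lemma norm_expInner (ξ x : E) : ‖expInner ξ x‖ = 1 := by
  rw [expInner, mul_comm, Complex.norm_exp_ofReal_mul_I]

lemma expInner_add (ξ x u : E) : expInner ξ (x + u) = expInner ξ x * expInner ξ u := by
  rw [expInner, inner_add_right, Complex.ofReal_add, mul_add, Complex.exp_add]; rfl

lemma norm_expInner_sub_one_le (ξ u : E) : ‖expInner ξ u - 1‖ ≤ ‖ξ‖ * ‖u‖ :=
  Real.norm_exp_I_mul_ofReal_sub_one_le.trans (norm_inner_le_norm _ _)

lemma isBoundedLipschitz_expInner (ξ : E) : IsBoundedLipschitz (1 + ‖ξ‖₊) (expInner ξ) := by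
  refine ⟨LipschitzWith.of_dist_le_mul fun x y => ?_, fun x => ?_⟩
  · have h : expInner ξ x - expInner ξ y = expInner ξ y * (expInner ξ (x - y) - 1) := by
      rw [mul_sub, ← expInner_add]; simp
    rw [dist_eq_norm, dist_eq_norm, h, norm_mul, norm_expInner, one_mul]
    refine (norm_expInner_sub_one_le _ _).trans ?_
    push_cast
    nlinarith [norm_nonneg (x - y), norm_nonneg ξ]
  · rw [norm_expInner]; simp

lemma hasDerivAt_I_mul_inner (ξ η x : E) (t : ℝ) :
    HasDerivAt (fun s : ℝ => Complex.I * ((⟪ξ + s • η, x⟫ : ℝ) : ℂ))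
      (Complex.I * ((⟪η, x⟫ : ℝ) : ℂ)) t := by
  have h : HasDerivAt (fun s : ℝ => ⟪ξ + s • η, x⟫) (⟪η, x⟫ : ℝ) t := by
    simp only [inner_add_left, real_inner_smul_left]
    simpa using ((hasDerivAt_id t).mul_const (⟪η, x⟫ : ℝ)).const_add (⟪ξ, x⟫ : ℝ)
  exact h.ofReal_comp.const_mul Complex.I

lemma hasDerivAt_expInner (ξ η x : E) (t : ℝ) :
    HasDerivAt (fun s : ℝ => expInner (ξ + s • η) x)
      (expInner (ξ + t • η) x * (Complex.I * ((⟪η, x⟫ : ℝ) : ℂ))) t :=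
  (hasDerivAt_I_mul_inner ξ η x t).cexp

variable [MeasurableSpace E] [BorelSpace E]

/-- The component along `η` of the covariance identity, for a complex test function. -/
def CovIdentity (μ ν : Measure E) (f : E → ℂ) (η : E) : Prop :=
  ∫ x, f x * ((⟪η, x⟫ : ℝ) : ℂ) ∂μ
    = (∫ x, f x ∂μ) * ((⟪η, ∫ x, x ∂μ⟫ : ℝ) : ℂ) + ∫ p, jumpIncrement f η p ∂μ.prod ν

lemma IsBoundedLipschitz.integrable_mul_inner {μ : Measure E} {K : ℝ≥0}
    (hμ : Integrable (fun x : E => x) μ)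
    {f : E → ℂ} (hf : IsBoundedLipschitz K f) (η : E) :
    Integrable (fun x => f x * ((⟪η, x⟫ : ℝ) : ℂ)) μ :=
  (hμ.const_inner η).ofReal.bdd_mul hf.1.continuous.aestronglyMeasurable (.of_forall hf.2)

/-- The logarithm of the characteristic function of the infinitely divisible law with mean `m`,
Lévy measure `ν` and no Gaussian component. -/
def levyExponent (m : E) (ν : Measure E) (ξ : E) : ℂ :=
  Complex.I * ((⟪m, ξ⟫ : ℝ) : ℂ)
    + ∫ u, (expInner ξ u - 1 - Complex.I * ((⟪ξ, u⟫ : ℝ) : ℂ)) ∂ν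

lemma hasDerivAt_integral_expInner {μ : Measure E} [IsProbabilityMeasure μ]
    (hμ : Integrable (fun x : E => x) μ) (ξ η : E) (t : ℝ) :
    HasDerivAt (fun s : ℝ => ∫ x, expInner (ξ + s • η) x ∂μ)
      (Complex.I * ∫ x, expInner (ξ + t • η) x * ((⟪η, x⟫ : ℝ) : ℂ) ∂μ) t := by
  have hi := fun ξ => (isBoundedLipschitz_expInner (E := E) ξ).integrable (μ := μ)
  have hj := fun ξ => (isBoundedLipschitz_expInner (E := E) ξ).integrable_mul_inner hμ η
  have h := (hasDerivAt_integral_of_dominated_loc_of_deriv_le (μ := μ)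
    (F := fun (s : ℝ) x => expInner (ξ + s • η) x)
    (F' := fun (s : ℝ) x => expInner (ξ + s • η) x * (Complex.I * ((⟪η, x⟫ : ℝ) : ℂ)))
    (bound := fun x => ‖(⟪η, x⟫ : ℝ)‖) (x₀ := t) univ_mem (.of_forall fun s => (hi _).1) (hi _)
    (((hj (ξ + t • η)).const_mul Complex.I).1.congr (.of_forall fun x => by ring))
    (.of_forall fun x s _ => ?_) (hμ.const_inner η).norm
    (.of_forall fun x s _ => hasDerivAt_expInner ξ η x s)).2
  · convert! h using 1
    rw [← integral_const_mul]
    exact integral_congr_ae (.of_forall fun x => by ring)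
  · simp [norm_expInner]

lemma integrable_expInner_sub_one_sub {ν : Measure E} (hν : Integrable levyWeight ν) (ξ : E) :
    Integrable (fun u => expInner ξ u - 1 - Complex.I * ((⟪ξ, u⟫ : ℝ) : ℂ)) ν := by
  have hc : Continuous fun u : E => expInner ξ u - 1 - Complex.I * ((⟪ξ, u⟫ : ℝ) : ℂ) := by
    unfold expInner; fun_prop
  refine (hν.const_mul (2 * (1 + ‖ξ‖) ^ 2)).mono' hc.aestronglyMeasurable (.of_forall fun u => ?_)
  refine (norm_exp_I_mul_sub_one_sub_le _).trans ?_
  have h1 : |(⟪ξ, u⟫ : ℝ)| ≤ (1 + ‖ξ‖) * ‖u‖ :=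
    (abs_real_inner_le_norm ξ u).trans (by gcongr; linarith)
  have h2 : min 1 |(⟪ξ, u⟫ : ℝ)| ≤ (1 + ‖ξ‖) * min 1 ‖u‖ := by
    rcases le_total 1 ‖u‖ with h | h
    · rw [min_eq_left h]
      linarith [min_le_left 1 |(⟪ξ, u⟫ : ℝ)|, norm_nonneg ξ]
    · rw [min_eq_right h]
      exact (min_le_right _ _).trans h1
  calc _ ≤ 2 * (((1 + ‖ξ‖) * min 1 ‖u‖) * ((1 + ‖ξ‖) * ‖u‖)) := by gcongr
    _ = _ := by rw [levyWeight]; ring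

lemma hasDerivAt_levyExponent {ν : Measure E} (hν : Integrable levyWeight ν) (m ξ η : E) (t : ℝ) :
    HasDerivAt (fun s : ℝ => levyExponent m ν (ξ + s • η))
      (Complex.I * (((⟪η, m⟫ : ℝ) : ℂ)
        + ∫ u, (expInner (ξ + t • η) u - 1) * ((⟪η, u⟫ : ℝ) : ℂ) ∂ν)) t := by
  have hi := integrable_expInner_sub_one_sub hν
  have hc : ∀ ξ : E, Continuous (expInner ξ) := fun ξ => (isBoundedLipschitz_expInner ξ).1.continuous
  have hbound : ∀ s ∈ Metric.ball t 1, ∀ u : E,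
      ‖(expInner (ξ + s • η) u - 1) * (Complex.I * ((⟪η, u⟫ : ℝ) : ℂ))‖
        ≤ 2 * (1 + (‖ξ‖ + (|t| + 1) * ‖η‖)) * ‖η‖ * levyWeight u := fun s hs u => by
    have h1 := (isBoundedLipschitz_expInner (ξ + s • η)).norm_jumpIncrement_le η (0, u)
    have h2 : ‖jumpIncrement (expInner (ξ + s • η)) η (0, u)‖
        = ‖(expInner (ξ + s • η) u - 1) * (Complex.I * ((⟪η, u⟫ : ℝ) : ℂ))‖ := by
      simp [jumpIncrement, expInner]
    have h3 : |s| ≤ |t| + 1 := by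
      have h4 : |s - t| < 1 := by simpa [Real.dist_eq] using hs
      linarith [abs_sub_abs_le_abs_sub s t]
    have h5 : ‖ξ + s • η‖ ≤ ‖ξ‖ + (|t| + 1) * ‖η‖ := by
      refine (norm_add_le _ _).trans ?_
      rw [norm_smul, Real.norm_eq_abs]
      gcongr
    rw [← h2]
    refine h1.trans ?_
    push_cast
    have := levyWeight_nonneg u
    gcongr
  have h := (hasDerivAt_integral_of_dominated_loc_of_deriv_le (μ := ν)
    (F := fun (s : ℝ) u =>
      expInner (ξ + s • η) u - 1 - Complex.I * ((⟪ξ + s • η, u⟫ : ℝ) : ℂ))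
    (F' := fun (s : ℝ) u => (expInner (ξ + s • η) u - 1) * (Complex.I * ((⟪η, u⟫ : ℝ) : ℂ)))
    (x₀ := t) (Metric.ball_mem_nhds t one_pos) (.of_forall fun s => (hi _).1) (hi _)
    (((hc _).sub continuous_const).mul (by fun_prop)).aestronglyMeasurable
    (.of_forall fun u s hs => hbound s hs u) (hν.const_mul _)
    (.of_forall fun u s _ => ?_)).2
  · convert! (hasDerivAt_I_mul_inner ξ η m t).add h using 1
    · ext s
      simp [levyExponent, real_inner_comm m]
    · rw [mul_add, ← integral_const_mul]
      congr 1
      exact integral_congr_ae (.of_forall fun u => by ring)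
  · convert! ((hasDerivAt_expInner ξ η u s).sub_const 1).sub (hasDerivAt_I_mul_inner ξ η u s) using 1
    ring

variable [FiniteDimensional ℝ E]

lemma integrable_jumpIncrement {μ ν : Measure E} [IsProbabilityMeasure μ] [SFinite ν]
    (hν : Integrable levyWeight ν) {K : ℝ≥0} {f : E → ℂ} (hf : IsBoundedLipschitz K f) (η : E) :
    Integrable (jumpIncrement f η) (μ.prod ν) :=
  ((hν.comp_snd μ).const_mul (2 * K * ‖η‖)).mono'
    (continuous_jumpIncrement hf.1.continuous η).aestronglyMeasurable
    (.of_forall (hf.norm_jumpIncrement_le η))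

/-- The covariance identity passes to pointwise limits of uniformly bounded and uniformly
Lipschitz functions. -/
lemma CovIdentity.of_tendsto {μ ν : Measure E} [IsProbabilityMeasure μ] [SFinite ν]
    (hμ : Integrable (fun x : E => x) μ) (hν : Integrable levyWeight ν) {K : ℝ≥0}
    {g : ℕ → E → ℂ} {f : E → ℂ} {η : E} (hg : ∀ n, IsBoundedLipschitz K (g n))
    (hlim : ∀ x, Tendsto (fun n => g n x) atTop (𝓝 (f x)))
    (h : ∀ n, CovIdentity μ ν (g n) η) : CovIdentity μ ν f η := by
  have h1 : Tendsto (fun n => ∫ x, g n x * ((⟪η, x⟫ : ℝ) : ℂ) ∂μ) atTop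
      (𝓝 (∫ x, f x * ((⟪η, x⟫ : ℝ) : ℂ) ∂μ)) := by
    refine tendsto_integral_of_dominated_convergence (fun x => K * ‖(⟪η, x⟫ : ℝ)‖)
      (fun n => ((hg n).integrable_mul_inner hμ η).1) ((hμ.const_inner η).norm.const_mul _)
      (fun n => .of_forall fun x => ?_) (.of_forall fun x => (hlim x).mul_const _)
    rw [norm_mul, Complex.norm_real]
    gcongr
    exact (hg n).2 x
  have h2 : Tendsto (fun n => ∫ x, g n x ∂μ) atTop (𝓝 (∫ x, f x ∂μ)) :=
    tendsto_integral_of_dominated_convergence (fun _ => (K : ℝ))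
      (fun n => (hg n).1.continuous.aestronglyMeasurable) (integrable_const _)
      (fun n => .of_forall (hg n).2) (.of_forall hlim)
  have h3 : Tendsto (fun n => ∫ p, jumpIncrement (g n) η p ∂μ.prod ν) atTop
      (𝓝 (∫ p, jumpIncrement f η p ∂μ.prod ν)) :=
    tendsto_integral_of_dominated_convergence (fun p => 2 * K * ‖η‖ * levyWeight p.2)
      (fun n => (integrable_jumpIncrement hν (hg n) η).1)
      ((hν.comp_snd μ).const_mul _) (fun n => .of_forall ((hg n).norm_jumpIncrement_le η))
      (.of_forall fun p => ((hlim _).sub (hlim _)).mul_const _)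
  exact tendsto_nhds_unique (h1.congr h) ((h2.mul_const _).add h3)

/-- A superposition of characters inherits the covariance identity. -/
lemma CovIdentity.of_superposition {μ ν : Measure E} [IsProbabilityMeasure μ] [SFinite ν]
    (hμ : Integrable (fun x : E => x) μ) (hν : Integrable levyWeight ν) {η : E}
    (h : ∀ ξ, CovIdentity μ ν (expInner ξ) η) {ρ : Measure E} [SFinite ρ] {w : E → ℂ} {k : E → E}
    (hw : Integrable w ρ) (hk : Continuous k) (hkw : Integrable (fun ξ => ‖k ξ‖ * ‖w ξ‖) ρ) :
    CovIdentity μ ν (fun x => ∫ ξ, w ξ * expInner (k ξ) x ∂ρ) η := by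
  have hc : Continuous fun p : E × E => expInner (k p.2) p.1 :=
    continuous_expInner.comp ((hk.comp continuous_snd).prodMk continuous_fst)
  have h1 : Integrable (fun p : E × E => w p.2 * expInner (k p.2) p.1 * ((⟪η, p.1⟫ : ℝ) : ℂ))
      (μ.prod ρ) := by
    refine ((hμ.const_inner η).ofReal.mul_prod hw).mono ?_ (.of_forall fun p => ?_)
    · exact (hw.1.comp_snd.mul hc.aestronglyMeasurable).mul
        (by fun_prop : Continuous fun p : E × E => ((⟪η, p.1⟫ : ℝ) : ℂ)).aestronglyMeasurable
    · simp [norm_expInner, mul_comm]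
  have h2 : Integrable (fun p : E × E => w p.2 * expInner (k p.2) p.1) (μ.prod ρ) :=
    (hw.comp_snd μ).mono (hw.1.comp_snd.mul hc.aestronglyMeasurable)
      (.of_forall fun p => by simp [norm_expInner])
  have hcj : Continuous fun p : (E × E) × E => jumpIncrement (expInner (k p.2)) η p.1 := by
    unfold jumpIncrement
    refine ((hc.comp (g := fun p : E × E => expInner (k p.2) p.1)
      (f := fun p : (E × E) × E => (p.1.1 + p.1.2, p.2)) (by fun_prop)).sub
      (hc.comp (f := fun p : (E × E) × E => (p.1.1, p.2)) (by fun_prop))).mul (by fun_prop)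
  have h3 : Integrable (fun p : (E × E) × E => w p.2 * jumpIncrement (expInner (k p.2)) η p.1)
      ((μ.prod ν).prod ρ) := by
    have hb : Integrable (fun ξ => (1 + ‖k ξ‖) * ‖w ξ‖) ρ := by
      simp only [add_mul, one_mul]
      exact hw.norm.add hkw
    refine (((hν.comp_snd μ).const_mul (2 * ‖η‖)).mul_prod hb).mono'
      (hw.1.comp_snd.mul hcj.aestronglyMeasurable) (.of_forall fun p => ?_)
    rw [norm_mul]
    calc _ ≤ ‖w p.2‖ * (2 * (1 + ‖k p.2‖₊ : ℝ≥0) * ‖η‖ * levyWeight p.1.2) := by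
          gcongr
          exact (isBoundedLipschitz_expInner _).norm_jumpIncrement_le _ _
      _ = _ := by push_cast; ring
  have h2' : ∀ x, Integrable (fun ξ => w ξ * expInner (k ξ) x) ρ := fun x =>
    hw.mono (hw.1.mul (hc.comp (by fun_prop : Continuous fun ξ : E => (x, ξ))).aestronglyMeasurable)
      (.of_forall fun p => by simp [norm_expInner])
  have e3 : ∀ p, jumpIncrement (fun x => ∫ ξ, w ξ * expInner (k ξ) x ∂ρ) η p
      = ∫ ξ, w ξ * jumpIncrement (expInner (k ξ)) η p ∂ρ := fun p => by
    simp only [jumpIncrement]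
    rw [← integral_sub (h2' _) (h2' _), ← integral_mul_const]
    exact integral_congr_ae (.of_forall fun ξ => by ring)
  unfold CovIdentity
  simp_rw [e3, ← integral_mul_const (μ := ρ)]
  rw [integral_integral_swap (f := fun x ξ => w ξ * expInner (k ξ) x * ((⟪η, x⟫ : ℝ) : ℂ)) h1,
    integral_integral_swap (f := fun x ξ => w ξ * expInner (k ξ) x) h2,
    integral_integral_swap (f := fun p ξ => w ξ * jumpIncrement (expInner (k ξ)) η p) h3,
    ← integral_mul_const]
  have i2 := h2.integral_prod_right.mul_const ((⟪η, ∫ x, x ∂μ⟫ : ℝ) : ℂ)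
  have i3 := h3.integral_prod_right
  rw [← integral_add i2 i3]
  refine integral_congr_ae (.of_forall fun ξ => ?_)
  simp only [mul_assoc, integral_const_mul]
  rw [← mul_add, h (k ξ)]

/-- A smooth compactly supported function is a superposition of characters. -/
lemma CovIdentity.of_contDiff_hasCompactSupport {μ ν : Measure E} [IsProbabilityMeasure μ]
    [SFinite ν] (hμ : Integrable (fun x : E => x) μ) (hν : Integrable levyWeight ν) {η : E}
    (h : ∀ ξ, CovIdentity μ ν (expInner ξ) η) {f : E → ℂ} (hf : ContDiff ℝ (⊤ : ℕ∞) f)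
    (hfc : HasCompactSupport f) : CovIdentity μ ν f η := by
  set g := hfc.toSchwartzMap hf with hg
  have hfg : f = fun x => ∫ ξ, FourierTransform.fourier g ξ * expInner ((2 * Real.pi) • ξ) x := by
    ext x
    have h1 : f x = FourierTransformInv.fourierInv (FourierTransform.fourier g) x := by
      rw [FourierTransform.fourierInv_fourier_eq]; rfl
    rw [h1, SchwartzMap.fourierInv_coe, Real.fourierInv_eq']
    refine integral_congr_ae (.of_forall fun ξ => ?_)
    simp only [smul_eq_mul, expInner, inner_smul_left]
    rw [mul_comm, mul_comm Complex.I]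
    simp
  rw [hfg]
  refine CovIdentity.of_superposition hμ hν h (FourierTransform.fourier g).integrable
    (by fun_prop) ?_
  have h1 := ((FourierTransform.fourier g).integrable_pow_mul volume 1).const_mul (2 * Real.pi)
  refine h1.congr (.of_forall fun ξ => ?_)
  simp only [norm_smul, pow_one, norm_mul, Real.norm_eq_abs, abs_two, abs_of_pos Real.pi_pos]
  ring

open ContinuousLinearMap in
/-- Averaging translates of a bounded Lipschitz function against a bump function preserves the
bound and the Lipschitz constant. -/
lemma IsBoundedLipschitz.convolution {K : ℝ≥0} {f : E → ℂ} (hf : IsBoundedLipschitz K f)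
    (φ : ContDiffBump (0 : E)) :
    IsBoundedLipschitz K (convolution (φ.normed volume) f (lsmul ℝ ℝ) volume) := by
  have hφ : Integrable (φ.normed volume) (volume : Measure E) := φ.integrable_normed
  have hi : ∀ x, Integrable (fun t => φ.normed volume t • f (x - t)) := fun x =>
    hφ.smul_bdd K (hf.1.continuous.comp (continuous_sub_left x)).aestronglyMeasurable
      (.of_forall fun t => hf.2 _)
  have hle : ∀ (C : ℝ) (F : E → ℂ), (∀ t, ‖F t‖ ≤ C) →
      ‖∫ t, φ.normed volume t • F t‖ ≤ C := fun C F hF => by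
    calc _ ≤ ∫ t, φ.normed volume t * C := by
          refine norm_integral_le_of_norm_le (hφ.mul_const C) (.of_forall fun t => ?_)
          rw [norm_smul, Real.norm_of_nonneg (φ.nonneg_normed t)]
          exact mul_le_mul_of_nonneg_left (hF t) (φ.nonneg_normed t)
      _ = C := by rw [integral_mul_const, φ.integral_normed, one_mul]
  refine ⟨LipschitzWith.of_dist_le_mul fun x y => ?_, fun x => hle K _ fun t => hf.2 _⟩
  simp only [convolution_def, lsmul_apply]
  rw [dist_eq_norm, ← integral_sub (hi x) (hi y)]
  simp only [← smul_sub]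
  refine hle _ _ fun t => ?_
  simpa [dist_eq_norm] using hf.1.dist_le_mul (x - t) (y - t)

lemma CovIdentity.of_isBoundedLipschitz_hasCompactSupport {μ ν : Measure E}
    [IsProbabilityMeasure μ] [SFinite ν] (hμ : Integrable (fun x : E => x) μ)
    (hν : Integrable levyWeight ν) {η : E} (h : ∀ ξ, CovIdentity μ ν (expInner ξ) η)
    {K : ℝ≥0} {f : E → ℂ} (hf : IsBoundedLipschitz K f) (hfc : HasCompactSupport f) :
    CovIdentity μ ν f η := by
  let φ : ℕ → ContDiffBump (0 : E) := fun n =>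
    ⟨1 / ((n : ℝ) + 1) / 2, 1 / ((n : ℝ) + 1), by positivity, half_lt_self (by positivity)⟩
  refine CovIdentity.of_tendsto hμ hν (fun n => hf.convolution (φ n)) (fun x =>
    ContDiffBump.convolution_tendsto_right_of_continuous
      tendsto_one_div_add_atTop_nhds_zero_nat hf.1.continuous x) fun n => ?_
  exact CovIdentity.of_contDiff_hasCompactSupport hμ hν h
    ((φ n).hasCompactSupport_normed.contDiff_convolution_left _ (φ n).contDiff_normed
      hf.1.continuous.locallyIntegrable)
    ((φ n).hasCompactSupport_normed.convolution _ hfc)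

/-- If the covariance identity holds for all characters, it holds for all bounded Lipschitz
functions. -/
lemma CovIdentity.of_isBoundedLipschitz {μ ν : Measure E} [IsProbabilityMeasure μ] [SFinite ν]
    (hμ : Integrable (fun x : E => x) μ) (hν : Integrable levyWeight ν) {η : E}
    (h : ∀ ξ, CovIdentity μ ν (expInner ξ) η) {K : ℝ≥0} {f : E → ℂ}
    (hf : IsBoundedLipschitz K f) : CovIdentity μ ν f η := by
  refine CovIdentity.of_tendsto hμ hν (fun n : ℕ => hf.radialCutoff_mul n) (fun x => ?_) fun n => ?_
  · refine tendsto_const_nhds.congr' ?_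
    filter_upwards [eventually_ge_atTop ⌈1 + ‖x‖⌉₊] with n hn
    have h1 : 1 ≤ (n : ℝ) - ‖x‖ := by linarith [Nat.ceil_le.1 hn]
    simp [radialCutoff, min_eq_left h1]
  · refine CovIdentity.of_isBoundedLipschitz_hasCompactSupport hμ hν h (hf.radialCutoff_mul n) ?_
    refine HasCompactSupport.intro (isCompact_closedBall (0 : E) n) fun x hx => ?_
    have h1 : (n : ℝ) - ‖x‖ < 0 := by simpa using hx
    have h2 : radialCutoff n x = 0 :=
      max_eq_left ((min_le_right _ _).trans h1.le)
    simp [h2]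

lemma covIdentity_expInner_iff {μ ν : Measure E} [IsProbabilityMeasure μ] [SFinite ν] (ξ η : E) :
    CovIdentity μ ν (expInner ξ) η ↔
      ∫ x, expInner ξ x * ((⟪η, x⟫ : ℝ) : ℂ) ∂μ
        = (∫ x, expInner ξ x ∂μ) * (((⟪η, ∫ x, x ∂μ⟫ : ℝ) : ℂ)
          + ∫ u, (expInner ξ u - 1) * ((⟪η, u⟫ : ℝ) : ℂ) ∂ν) := by
  have h : ∫ p, jumpIncrement (expInner ξ) η p ∂μ.prod ν
      = (∫ x, expInner ξ x ∂μ) * ∫ u, (expInner ξ u - 1) * ((⟪η, u⟫ : ℝ) : ℂ) ∂ν := by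
    rw [← integral_prod_mul]
    refine integral_congr_ae (.of_forall fun p => ?_)
    simp only [jumpIncrement, expInner_add]
    ring
  rw [CovIdentity, h, mul_add]

/-- The covariance identity for all characters is the differential equation satisfied by the
characteristic function. -/
lemma forall_covIdentity_expInner_iff {μ ν : Measure E} [IsProbabilityMeasure μ] [SFinite ν]
    (hμ : Integrable (fun x : E => x) μ) (hν : Integrable levyWeight ν) :
    (∀ ξ η, CovIdentity μ ν (expInner ξ) η) ↔
      ∀ ξ, ∫ x, expInner ξ x ∂μ = Complex.exp (levyExponent (∫ x, x ∂μ) ν ξ) := by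
  simp only [covIdentity_expInner_iff]
  refine ⟨fun h ξ => ?_, fun h ξ η => ?_⟩
  · have hd : ∀ t : ℝ, HasDerivAt (fun s : ℝ => (∫ x, expInner (0 + s • ξ) x ∂μ)
        * Complex.exp (-levyExponent (∫ x, x ∂μ) ν (0 + s • ξ))) 0 t := fun t => by
      convert! (hasDerivAt_integral_expInner hμ 0 ξ t).mul
        (hasDerivAt_levyExponent hν (∫ x, x ∂μ) 0 ξ t).neg.cexp using 1
      rw [h]
      ring
    have hc := is_const_of_deriv_eq_zero (fun t => (hd t).differentiableAt) (fun t => (hd t).deriv)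
      1 0
    simp only [one_smul, zero_add, zero_smul] at hc
    have h0 : levyExponent (∫ x, x ∂μ) ν 0 = 0 := by simp [levyExponent, expInner]
    have h1 : ∫ x : E, expInner 0 x ∂μ = 1 := by simp [expInner]
    rw [h0, h1, neg_zero, Complex.exp_zero, Complex.exp_neg,
      mul_inv_eq_iff_eq_mul₀ (Complex.exp_ne_zero _)] at hc
    simpa using hc
  · have h1 := hasDerivAt_integral_expInner hμ ξ η 0
    simp only [h] at h1
    have h2 := h1.unique (hasDerivAt_levyExponent hν (∫ x, x ∂μ) ξ η 0).cexp
    simp only [zero_smul, add_zero, ← h] at h2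
    refine mul_left_cancel₀ Complex.I_ne_zero (h2.trans ?_)
    ring

/-- The vector-valued covariance identity for a real test function, tested against every
direction. -/
lemma covIdentity_ofReal_iff {μ ν : Measure E} [IsProbabilityMeasure μ] [SFinite ν]
    (hμ : Integrable (fun x : E => x) μ) (hν : Integrable levyWeight ν) {K : ℝ≥0} {f : E → ℝ}
    (hf : IsBoundedLipschitz K fun x => (f x : ℂ)) :
    (∫ x, f x • x ∂μ
      = (∫ x, f x ∂μ) • (∫ x, x ∂μ) + ∫ x, ∫ u, (f (x + u) - f x) • u ∂ν ∂μ)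
      ↔ ∀ η, CovIdentity μ ν (fun x => (f x : ℂ)) η := by
  have hcont : Continuous f := Complex.continuous_re.comp hf.1.continuous
  have h1 : Integrable (fun x => f x • x) μ :=
    hμ.bdd_smul K hcont.aestronglyMeasurable (.of_forall fun x => by simpa using hf.2 x)
  have h2 : Integrable (fun p : E × E => (f (p.1 + p.2) - f p.1) • p.2) (μ.prod ν) := by
    refine ((hν.comp_snd μ).const_mul (2 * K)).mono'
      (by fun_prop : Continuous fun p : E × E =>
        (f (p.1 + p.2) - f p.1) • p.2).aestronglyMeasurable (.of_forall fun p => ?_)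
    have h3 : ‖f (p.1 + p.2) - f p.1‖ ≤ 2 * K * min 1 ‖p.2‖ := by
      rw [← Complex.norm_real]
      simpa using hf.norm_sub_le p.1 p.2
    rw [norm_smul, levyWeight, ← mul_assoc]
    gcongr
  rw [← integral_prod _ h2, ext_iff_inner_left ℝ]
  refine forall_congr' fun η => ?_
  rw [inner_add_right, ← integral_inner h1, ← integral_inner h2, CovIdentity]
  simp only [inner_smul_right, jumpIncrement]
  norm_cast

lemma CovIdentity.of_re_im {μ ν : Measure E} [IsProbabilityMeasure μ] [SFinite ν]
    (hμ : Integrable (fun x : E => x) μ) (hν : Integrable levyWeight ν) {K : ℝ≥0} {f : E → ℂ}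
    (hf : IsBoundedLipschitz K f) {η : E} (hre : CovIdentity μ ν (fun x => ((f x).re : ℂ)) η)
    (him : CovIdentity μ ν (fun x => ((f x).im : ℂ)) η) : CovIdentity μ ν f η := by
  have e1 : ∫ x, f x * ((⟪η, x⟫ : ℝ) : ℂ) ∂μ
      = ∫ x, ((f x).re : ℂ) * ((⟪η, x⟫ : ℝ) : ℂ) ∂μ
        + Complex.I * ∫ x, ((f x).im : ℂ) * ((⟪η, x⟫ : ℝ) : ℂ) ∂μ := by
    rw [← integral_const_mul, ← integral_add (hf.re.integrable_mul_inner hμ η)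
      ((hf.im.integrable_mul_inner hμ η).const_mul _)]
    refine integral_congr_ae (.of_forall fun x => ?_)
    linear_combination (-((⟪η, x⟫ : ℝ) : ℂ)) * Complex.re_add_im (f x)
  have e2 : ∫ x, f x ∂μ = ∫ x, ((f x).re : ℂ) ∂μ + Complex.I * ∫ x, ((f x).im : ℂ) ∂μ := by
    rw [← integral_const_mul, ← integral_add hf.re.integrable (hf.im.integrable.const_mul _)]
    refine integral_congr_ae (.of_forall fun x => ?_)
    linear_combination -Complex.re_add_im (f x)
  have e3 : ∫ p, jumpIncrement f η p ∂μ.prod ν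
      = ∫ p, jumpIncrement (fun x => ((f x).re : ℂ)) η p ∂μ.prod ν
        + Complex.I * ∫ p, jumpIncrement (fun x => ((f x).im : ℂ)) η p ∂μ.prod ν := by
    rw [← integral_const_mul, ← integral_add (integrable_jumpIncrement hν hf.re η)
      ((integrable_jumpIncrement hν hf.im η).const_mul _)]
    refine integral_congr_ae (.of_forall fun p => ?_)
    simp only [jumpIncrement]
    linear_combination (-((⟪η, p.2⟫ : ℝ) : ℂ))
      * (Complex.re_add_im (f (p.1 + p.2)) - Complex.re_add_im (f p.1))
  unfold CovIdentity at hre him ⊢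
  rw [e1, e2, e3, hre, him]
  ring

/-- Characterization of infinitely divisible random vectors with finite first moment
via a covariance-type identity (Theorem 2.1). -/
theorem stmt0 {d : ℕ} (μ ν : Measure (EuclideanSpace ℝ (Fin d)))
    [IsProbabilityMeasure μ]
    (hint : ∀ i : Fin d, Integrable (fun x : EuclideanSpace ℝ (Fin d) => x i) μ)
    (hLevy : IsLevyMeasure ν)
    (hν1 : ∫⁻ u in {u : EuclideanSpace ℝ (Fin d) | 1 ≤ ‖u‖}, ENNReal.ofReal ‖u‖ ∂ν < ⊤) :
    (∀ f : EuclideanSpace ℝ (Fin d) → ℝ,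
        (∃ K : ℝ≥0, LipschitzWith K f) → (∃ C : ℝ, ∀ x, |f x| ≤ C) →
        ∫ x, f x • x ∂μ
          = (∫ x, f x ∂μ) • (∫ x, x ∂μ)
            + ∫ x, ∫ u, (f (x + u) - f x) • u ∂ν ∂μ)
      ↔ (∀ ξ, charFn μ ξ
          = Complex.exp (Complex.I * ((⟪∫ x, x ∂μ, ξ⟫ : ℝ) : ℂ)
              + ∫ u, (Complex.exp (Complex.I * ((⟪u, ξ⟫ : ℝ) : ℂ)) - 1
                  - Complex.I * ((⟪u, ξ⟫ : ℝ) : ℂ)) ∂ν)) := by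
  have hμ : Integrable (fun x : EuclideanSpace ℝ (Fin d) => x) μ := .of_eval_piLp hint
  have hν : Integrable levyWeight ν := integrable_levyWeight hLevy.2 hν1
  have : SFinite ν := sFinite_of_integrable_levyWeight hLevy.1 hν
  have hchar : (∀ ξ, charFn μ ξ
      = Complex.exp (Complex.I * ((⟪∫ x, x ∂μ, ξ⟫ : ℝ) : ℂ)
          + ∫ u, (Complex.exp (Complex.I * ((⟪u, ξ⟫ : ℝ) : ℂ)) - 1
              - Complex.I * ((⟪u, ξ⟫ : ℝ) : ℂ)) ∂ν))
      ↔ ∀ ξ, ∫ x, expInner ξ x ∂μ = Complex.exp (levyExponent (∫ x, x ∂μ) ν ξ) := by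
    refine forall_congr' fun ξ => ?_
    simp only [real_inner_comm ξ, levyExponent, expInner, charFn]
  rw [hchar, ← forall_covIdentity_expInner_iff hμ hν]
  refine ⟨fun h ξ η => ?_, fun h f ⟨K, hK⟩ ⟨C, hC⟩ => ?_⟩
  · have hreal : ∀ (L : ℝ≥0) (f : EuclideanSpace ℝ (Fin d) → ℝ),
        IsBoundedLipschitz L (fun x => (f x : ℂ)) → CovIdentity μ ν (fun x => (f x : ℂ)) η :=
      fun L f hf => (covIdentity_ofReal_iff hμ hν hf).1 (h f
        ⟨L, LipschitzWith.of_dist_le_mul fun x y => by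
          simpa [dist_eq_norm, ← Complex.ofReal_sub] using hf.1.dist_le_mul x y⟩
        ⟨L, fun x => by simpa using hf.2 x⟩) η
    have hξ := isBoundedLipschitz_expInner ξ
    exact .of_re_im hμ hν hξ (hreal _ _ hξ.re) (hreal _ _ hξ.im)
  · have hf : IsBoundedLipschitz (max K C.toNNReal) fun x => (f x : ℂ) :=
      ⟨LipschitzWith.of_dist_le_mul fun x y => by
        simpa [dist_eq_norm, ← Complex.ofReal_sub] using (hK.weaken (le_max_left K C.toNNReal)).dist_le_mul x y,
        fun x => by simpa using Or.inr (.inl (hC x))⟩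
    exact (covIdentity_ofReal_iff hμ hν hf).2 fun η =>
      .of_isBoundedLipschitz hμ hν (fun ξ => h ξ η) hf
end
end

section
/- Let X be a random vector in ℝ^d, let b ∈ ℝ^d, let α ∈ (0,1), and let ν be a Lévy measure on ℝ^d satisfying the scaling relation ν(cB) = c^{−α} ν(B) for every c > 0 and every Borel set B ⊆ ℝ^d. Set b₀ = b − ∫_{‖u‖≤1} u ν(du). Then the identity E[⟨X, ∇f(X)⟩] = ⟨b₀, E[∇f(X)]⟩ + α E[∫_{ℝ^d} (f(X+u) − f(X)) ν(du)] holds for every Schwartz function f ∈ S(ℝ^d) if and only if the characteristic function of X equals φ(ξ) = exp( i⟨ξ, b₀⟩ + ∫_{ℝ^d} (e^{i⟨ξ,u⟩} − 1) ν(du) ) for all ξ ∈ ℝ^d, i.e., X is an α-stable random vector with parameter b, stability index α and Lévy measure ν. -/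
open MeasureTheory ProbabilityTheory Filter Set
open scoped RealInnerProductSpace ENNReal NNReal Topology Pointwise

noncomputable section

section LevyMeasure

variable {E : Type*} [NormedAddCommGroup E] [MeasurableSpace E] [BorelSpace E] {ν : Measure E}
  {α : ℝ}

theorem sigmaFinite_of_lintegral_min_one_sq_lt_top (h0 : ν {0} = 0)
    (hfin : ∫⁻ u, ENNReal.ofReal (min 1 (‖u‖ ^ 2)) ∂ν < ⊤) : SigmaFinite ν := by
  have hm : Measurable fun u : E => ENNReal.ofReal (min 1 (‖u‖ ^ 2)) := by fun_prop
  have hne : ∀ᵐ u ∂ν, ENNReal.ofReal (min 1 (‖u‖ ^ 2)) ≠ 0 := by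
    have hz : ∀ᵐ u ∂ν, u ∉ ({0} : Set E) := measure_eq_zero_iff_ae_notMem.mp h0
    filter_upwards [hz] with u hu
    have : 0 < ‖u‖ := norm_pos_iff.mpr hu
    exact (ENNReal.ofReal_pos.mpr (by positivity)).ne'
  have : IsFiniteMeasure (ν.withDensity fun u => ENNReal.ofReal (min 1 (‖u‖ ^ 2))) :=
    isFiniteMeasure_withDensity hfin.ne
  rw [← withDensity_inv_same hm hne (by simp)]
  refine SigmaFinite.withDensity_of_ne_top ?_
  have hac := withDensity_absolutelyContinuous ν fun u : E => ENNReal.ofReal (min 1 (‖u‖ ^ 2))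
  filter_upwards [hac.ae_le hne] with u hu
  simpa using hu

variable [NormedSpace ℝ E]

theorem map_smul_of_scaling
    (hscal : ∀ c : ℝ, 0 < c → ∀ B : Set E, MeasurableSet B →
      ν (c • B) = ENNReal.ofReal (c ^ (-α)) * ν B) {c : ℝ} (hc : 0 < c) :
    ν.map (c • ·) = ENNReal.ofReal (c ^ α) • ν := by
  ext B hB
  rw [Measure.map_apply (measurable_const_smul c) hB, preimage_smul₀ hc.ne',
    hscal _ (inv_pos.mpr hc) B hB, Real.inv_rpow hc.le, Real.rpow_neg hc.le, inv_inv]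
  simp

theorem integral_comp_smul_of_scaling {F : Type*} [NormedAddCommGroup F] [NormedSpace ℝ F]
    (hscal : ∀ c : ℝ, 0 < c → ∀ B : Set E, MeasurableSet B →
      ν (c • B) = ENNReal.ofReal (c ^ (-α)) * ν B) {c : ℝ} (hc : 0 < c) (g : E → F) :
    ∫ u, g (c • u) ∂ν = c ^ α • ∫ u, g u ∂ν := by
  have h := (Homeomorph.smulOfNeZero c hc.ne').isClosedEmbedding.measurableEmbedding.integral_map
    (μ := ν) g
  simp only [Homeomorph.smulOfNeZero_apply] at h
  rw [← h, show (fun x : E => c • x) = (c • ·) from rfl, map_smul_of_scaling hscal hc,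
    integral_smul_measure, ENNReal.toReal_ofReal (Real.rpow_nonneg hc.le _)]

theorem integrable_min_one_norm (hα : α ∈ Ioo (0 : ℝ) 1)
    (hfin : ∫⁻ u, ENNReal.ofReal (min 1 (‖u‖ ^ 2)) ∂ν < ⊤)
    (hscal : ∀ c : ℝ, 0 < c → ∀ B : Set E, MeasurableSet B →
      ν (c • B) = ENNReal.ofReal (c ^ (-α)) * ν B) :
    Integrable (fun u => min 1 ‖u‖) ν := by
  have hset : MeasurableSet {u : E | 1 < ‖u‖} := measurableSet_lt measurable_const measurable_norm
  have htail : ν {u : E | 1 < ‖u‖} < ⊤ := by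
    calc ν {u : E | 1 < ‖u‖} = ∫⁻ u in {u : E | 1 < ‖u‖}, 1 ∂ν := by simp
      _ ≤ ∫⁻ u in {u : E | 1 < ‖u‖}, ENNReal.ofReal (min 1 (‖u‖ ^ 2)) ∂ν := by
        refine setLIntegral_mono (by fun_prop) fun u hu => ?_
        have hu : 1 < ‖u‖ := hu
        rw [min_eq_left (one_le_pow₀ hu.le)]
        simp
      _ ≤ _ := setLIntegral_le_lintegral _ _
      _ < ⊤ := hfin
  refine ⟨by fun_prop, ?_⟩
  rw [hasFiniteIntegral_iff_ofReal (Eventually.of_forall fun u => by positivity),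
    lintegral_eq_lintegral_meas_lt ν (Eventually.of_forall fun u => by positivity) (by fun_prop)]
  have hle : ∀ t ∈ Ioi (0 : ℝ), ν {u : E | t < min 1 ‖u‖} ≤
      (Ioc (0 : ℝ) 1).indicator
        (fun t => ENNReal.ofReal (t ^ (-α)) * ν {u : E | 1 < ‖u‖}) t := by
    intro t (ht : 0 < t)
    by_cases h1 : t ≤ 1
    · rw [indicator_of_mem (mem_Ioc.mpr ⟨ht, h1⟩), ← hscal t ht _ hset]
      refine measure_mono fun u (hu : t < min 1 ‖u‖) => ?_
      rw [mem_smul_set_iff_inv_smul_mem₀ ht.ne']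
      change 1 < ‖t⁻¹ • u‖
      rw [norm_smul, norm_inv, Real.norm_of_nonneg ht.le, ← div_eq_inv_mul, one_lt_div ht]
      exact hu.trans_le (min_le_right _ _)
    · have hempty : {u : E | t < min 1 ‖u‖} = ∅ :=
        eq_empty_of_forall_notMem fun u (hu : t < min 1 ‖u‖) =>
          h1 (hu.trans_le (min_le_left _ _)).le
      rw [hempty, measure_empty]
      exact zero_le
  refine (setLIntegral_mono' measurableSet_Ioi hle).trans_lt ?_
  refine (setLIntegral_le_lintegral _ _).trans_lt ?_
  rw [lintegral_indicator measurableSet_Ioc, lintegral_mul_const' _ _ htail.ne]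
  refine ENNReal.mul_lt_top ?_ htail
  have hint : IntegrableOn (fun t : ℝ => t ^ (-α)) (Ioc 0 1) := by
    rw [← intervalIntegrable_iff_integrableOn_Ioc_of_le zero_le_one]
    exact intervalIntegral.intervalIntegrable_rpow' (by linarith [hα.2])
  exact hint.lintegral_lt_top

end LevyMeasure

section JumpOperator

variable {E F : Type*} [NormedAddCommGroup E] [NormedSpace ℝ E] [NormedAddCommGroup F]
  [NormedSpace ℝ F] {g : E → F} {K : ℝ}

theorem norm_increment_le (hg : Differentiable ℝ g) (hK : ∀ x, ‖g x‖ ≤ K)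
    (hK' : ∀ x, ‖fderiv ℝ g x‖ ≤ K) (x u : E) :
    ‖g (x + u) - g x‖ ≤ 2 * K * min 1 ‖u‖ := by
  have hK0 : 0 ≤ K := (norm_nonneg _).trans (hK x)
  rcases le_total ‖u‖ 1 with h | h
  · have := Convex.norm_image_sub_le_of_norm_fderiv_le (𝕜 := ℝ) (f := g) (C := K)
      (fun y _ => hg y) (fun y _ => hK' y) convex_univ (mem_univ x) (mem_univ (x + u))
    rw [add_sub_cancel_left] at this
    rw [min_eq_right h]
    nlinarith [mul_nonneg hK0 (norm_nonneg u)]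
  · rw [min_eq_left h]
    linarith [norm_sub_le (g (x + u)) (g x), hK (x + u), hK x]

variable [MeasurableSpace E] {ν : Measure E}

/-- The generator of the pure jump process without compensation and with jump measure `ν`. -/
def jumpOperator (ν : Measure E) (g : E → F) (x : E) : F :=
  ∫ u, (g (x + u) - g x) ∂ν

theorem norm_jumpOperator_le (hν : Integrable (fun u => min 1 ‖u‖) ν) (hg : Differentiable ℝ g)
    (hK : ∀ x, ‖g x‖ ≤ K) (hK' : ∀ x, ‖fderiv ℝ g x‖ ≤ K) (x : E) :
    ‖jumpOperator ν g x‖ ≤ 2 * K * ∫ u, min 1 ‖u‖ ∂ν := by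
  rw [← integral_const_mul]
  exact norm_integral_le_of_norm_le (hν.const_mul (2 * K))
    (Eventually.of_forall fun u => norm_increment_le hg hK hK' x u)

variable [BorelSpace E]

theorem jumpOperator_comp_smul {α : ℝ}
    (hscal : ∀ c : ℝ, 0 < c → ∀ B : Set E, MeasurableSet B →
      ν (c • B) = ENNReal.ofReal (c ^ (-α)) * ν B) {c : ℝ} (hc : 0 < c) (g : E → F) (x : E) :
    jumpOperator ν (fun y => g (c • y)) x = c ^ α • jumpOperator ν g (c • x) := by
  simp only [jumpOperator, smul_add]
  exact integral_comp_smul_of_scaling hscal hc fun u => g (c • x + u) - g (c • x)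

variable [SecondCountableTopology E]

theorem integrable_increment (hν : Integrable (fun u => min 1 ‖u‖) ν) (hg : Differentiable ℝ g)
    (hK : ∀ x, ‖g x‖ ≤ K) (hK' : ∀ x, ‖fderiv ℝ g x‖ ≤ K) (x : E) :
    Integrable (fun u => g (x + u) - g x) ν := by
  have := hg.continuous
  exact (hν.const_mul (2 * K)).mono' (by fun_prop)
    (Eventually.of_forall fun u => norm_increment_le hg hK hK' x u)

theorem continuous_jumpOperator (hν : Integrable (fun u => min 1 ‖u‖) ν)
    (hg : Differentiable ℝ g) (hK : ∀ x, ‖g x‖ ≤ K) (hK' : ∀ x, ‖fderiv ℝ g x‖ ≤ K) :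
    Continuous (jumpOperator ν g) := by
  have := hg.continuous
  exact continuous_of_dominated (bound := fun u => 2 * K * min 1 ‖u‖)
    (fun x => (integrable_increment hν hg hK hK' x).aestronglyMeasurable)
    (fun x => Eventually.of_forall fun u => norm_increment_le hg hK hK' x u) (hν.const_mul _)
    (Eventually.of_forall fun u => by fun_prop)

theorem integrable_jumpOperator {μ : Measure E} [IsFiniteMeasure μ]
    (hν : Integrable (fun u => min 1 ‖u‖) ν)
    (hg : Differentiable ℝ g) (hK : ∀ x, ‖g x‖ ≤ K) (hK' : ∀ x, ‖fderiv ℝ g x‖ ≤ K) :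
    Integrable (jumpOperator ν g) μ :=
  .of_bound (continuous_jumpOperator hν hg hK hK').aestronglyMeasurable _
    (Eventually.of_forall fun x => norm_jumpOperator_le hν hg hK hK' x)

end JumpOperator

section SteinIdentity

variable {E F : Type*} [NormedAddCommGroup E] [NormedSpace ℝ E] [MeasurableSpace E]
  [NormedAddCommGroup F] [NormedSpace ℝ F] {μ ν : Measure E} {g : E → F} {K α : ℝ} {b₀ : E}

/-- The Stein identity for a stable law with drift `b₀`, stability index `α` and Lévy measure `ν`,
tested on `g`. -/
def SteinIdentity (μ ν : Measure E) (b₀ : E) (α : ℝ) (g : E → F) : Prop :=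
  ∫ x, fderiv ℝ g x x ∂μ = ∫ x, fderiv ℝ g x b₀ ∂μ + α • ∫ x, jumpOperator ν g x ∂μ

/-- The bounded right-hand side of the rescaled Stein identity. -/
def scaledSteinRHS (μ ν : Measure E) (b₀ : E) (α : ℝ) (g : E → F) (c : ℝ) : F :=
  ∫ x, fderiv ℝ g (c • x) b₀ ∂μ + (α * c ^ (α - 1)) • ∫ x, jumpOperator ν g (c • x) ∂μ

theorem norm_scaledSteinRHS_le [IsProbabilityMeasure μ] (hν : Integrable (fun u => min 1 ‖u‖) ν)
    (hα : 0 ≤ α) (hg : Differentiable ℝ g) (hK : ∀ x, ‖g x‖ ≤ K)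
    (hK' : ∀ x, ‖fderiv ℝ g x‖ ≤ K) {c : ℝ} (hc : 0 < c) :
    ‖scaledSteinRHS μ ν b₀ α g c‖ ≤
      K * ‖b₀‖ + α * c ^ (α - 1) * (2 * K * ∫ u, min 1 ‖u‖ ∂ν) := by
  refine (norm_add_le _ _).trans (add_le_add ?_ ?_)
  · simpa using norm_integral_le_of_norm_le_const (μ := μ) (C := K * ‖b₀‖)
      (Eventually.of_forall fun x => (fderiv ℝ g (c • x)).le_of_opNorm_le (hK' _) b₀)
  · rw [norm_smul, Real.norm_of_nonneg (by positivity)]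
    gcongr
    simpa using norm_integral_le_of_norm_le_const (μ := μ) (C := 2 * K * ∫ u, min 1 ‖u‖ ∂ν)
      (Eventually.of_forall fun x => norm_jumpOperator_le hν hg hK hK' (c • x))

variable [BorelSpace E] [SecondCountableTopology E]

theorem integrable_fderiv_apply [IsFiniteMeasure μ] (hg : ContDiff ℝ 1 g)
    (hK' : ∀ x, ‖fderiv ℝ g x‖ ≤ K) (v : E) : Integrable (fun x => fderiv ℝ g x v) μ := by
  have := hg.continuous_fderiv one_ne_zero
  exact .of_bound (by fun_prop) (K * ‖v‖)
    (Eventually.of_forall fun x => (fderiv ℝ g x).le_of_opNorm_le (hK' x) v)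

theorem hasDerivAt_integral_comp_smul [IsFiniteMeasure μ] (hg : ContDiff ℝ 1 g)
    (hK : ∀ x, ‖g x‖ ≤ K) (hr : ∀ x, ‖fderiv ℝ g x x‖ ≤ K) {c : ℝ} (hc : 0 < c) :
    HasDerivAt (fun t : ℝ => ∫ x, g (t • x) ∂μ) (∫ x, fderiv ℝ g (c • x) x ∂μ) c := by
  have hcont := hg.continuous
  have hcont' := hg.continuous_fderiv one_ne_zero
  refine (hasDerivAt_integral_of_dominated_loc_of_deriv_le (bound := fun _ => 2 * K / c)
    (F' := fun t x => fderiv ℝ g (t • x) x) (Ioi_mem_nhds (half_lt_self hc))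
    (Eventually.of_forall fun t => by fun_prop) (.of_bound (by fun_prop) K
      (Eventually.of_forall fun x => hK _)) (by fun_prop)
    (Eventually.of_forall fun x t ht => ?_) (integrable_const _)
    (Eventually.of_forall fun x t _ => ?_)).2
  · have ht : c / 2 < t := ht
    have ht0 : 0 < t := by linarith
    have h := hr (t • x)
    rw [map_smul, norm_smul, Real.norm_of_nonneg ht0.le] at h
    rw [le_div_iff₀ hc]
    nlinarith [norm_nonneg (fderiv ℝ g (t • x) x)]
  · have h1 : HasDerivAt (fun t : ℝ => t • x) x t := by
      simpa using (hasDerivAt_id t).smul_const x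
    exact ((hg.differentiable one_ne_zero (t • x)).hasFDerivAt.comp_hasDerivAt t h1)

theorem SteinIdentity.hasDerivAt [IsFiniteMeasure μ] (hg : ContDiff ℝ 1 g)
    (hK : ∀ x, ‖g x‖ ≤ K) (hr : ∀ x, ‖fderiv ℝ g x x‖ ≤ K)
    (hscal : ∀ c : ℝ, 0 < c → ∀ B : Set E, MeasurableSet B →
      ν (c • B) = ENNReal.ofReal (c ^ (-α)) * ν B) {c : ℝ} (hc : 0 < c)
    (h : SteinIdentity μ ν b₀ α fun x => g (c • x)) :
    HasDerivAt (fun t : ℝ => ∫ x, g (t • x) ∂μ) (scaledSteinRHS μ ν b₀ α g c) c := by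
  convert hasDerivAt_integral_comp_smul (μ := μ) hg hK hr hc using 1
  simp only [SteinIdentity, jumpOperator_comp_smul hscal hc, integral_smul, fderiv_comp_smul,
    smul_apply, smul_smul] at h
  apply (smul_right_injective F hc.ne')
  simp only [scaledSteinRHS, smul_add, smul_smul]
  rw [h, mul_left_comm, Real.rpow_sub_one hc.ne', mul_div_cancel₀ _ hc.ne']

theorem continuousOn_scaledSteinRHS [IsProbabilityMeasure μ]
    (hν : Integrable (fun u => min 1 ‖u‖) ν) (hg : ContDiff ℝ 1 g)
    (hK : ∀ x, ‖g x‖ ≤ K) (hK' : ∀ x, ‖fderiv ℝ g x‖ ≤ K) :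
    ContinuousOn (scaledSteinRHS μ ν b₀ α g) (Ioi 0) := by
  have hcont := hg.continuous_fderiv one_ne_zero
  have hjump := continuous_jumpOperator hν (hg.differentiable one_ne_zero) hK hK'
  have h1 : Continuous fun c : ℝ => ∫ x, fderiv ℝ g (c • x) b₀ ∂μ :=
    continuous_of_dominated (bound := fun _ => K * ‖b₀‖) (fun c => by fun_prop)
      (fun c => Eventually.of_forall fun x => (fderiv ℝ g (c • x)).le_of_opNorm_le (hK' _) b₀)
      (integrable_const _) (Eventually.of_forall fun x => by fun_prop)
  have h2 : Continuous fun c : ℝ => ∫ x, jumpOperator ν g (c • x) ∂μ :=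
    continuous_of_dominated (bound := fun _ => 2 * K * ∫ u, min 1 ‖u‖ ∂ν)
      (fun c => by fun_prop) (fun c => Eventually.of_forall fun x =>
        norm_jumpOperator_le hν (hg.differentiable one_ne_zero) hK hK' _)
      (integrable_const _) (Eventually.of_forall fun x => by fun_prop)
  refine h1.continuousOn.add (ContinuousOn.smul ?_ h2.continuousOn)
  exact continuousOn_const.mul fun c (hc : 0 < c) =>
    (Real.continuousAt_rpow_const _ _ (Or.inl hc.ne')).continuousWithinAt

theorem integral_scaledSteinRHS [CompleteSpace F] [IsProbabilityMeasure μ]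
    (hν : Integrable (fun u => min 1 ‖u‖) ν)
    (hg : ContDiff ℝ 1 g) (hK : ∀ x, ‖g x‖ ≤ K) (hK' : ∀ x, ‖fderiv ℝ g x‖ ≤ K)
    (hr : ∃ R, ∀ x, ‖fderiv ℝ g x x‖ ≤ R)
    (hscal : ∀ c : ℝ, 0 < c → ∀ B : Set E, MeasurableSet B →
      ν (c • B) = ENNReal.ofReal (c ^ (-α)) * ν B)
    (h : ∀ c : ℝ, 0 < c → SteinIdentity μ ν b₀ α fun x => g (c • x)) {s t : ℝ}
    (hs : 0 < s) (hst : s ≤ t) :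
    ∫ c in s..t, scaledSteinRHS μ ν b₀ α g c = ∫ x, g (t • x) ∂μ - ∫ x, g (s • x) ∂μ := by
  obtain ⟨R, hR⟩ := hr
  have hderiv : ∀ c ∈ Ioi (0 : ℝ), HasDerivAt (fun t : ℝ => ∫ x, g (t • x) ∂μ)
      (scaledSteinRHS μ ν b₀ α g c) c := fun c hc =>
    (h c hc).hasDerivAt (K := max K R) hg (fun x => (hK x).trans (le_max_left _ _))
      (fun x => (hR x).trans (le_max_right _ _)) hscal hc
  have hpos : ∀ c ∈ uIcc s t, 0 < c := fun c hc => by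
    rw [uIcc_of_le hst] at hc
    exact hs.trans_le hc.1
  exact intervalIntegral.integral_eq_sub_of_hasDerivAt (fun c hc => hderiv c (hpos c hc))
    ((continuousOn_scaledSteinRHS hν hg hK hK').mono hpos).intervalIntegrable

end SteinIdentity

section Truncation

variable {E F : Type*} [NormedAddCommGroup E] [NormedSpace ℝ E] [MeasurableSpace E] [BorelSpace E]
  [SecondCountableTopology E] [NormedAddCommGroup F] [NormedSpace ℝ F] {μ ν : Measure E}
  [IsProbabilityMeasure μ] {g : E → F} {G : ℕ → E → F} {K α : ℝ} {b₀ : E}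

theorem tendsto_scaledSteinRHS (hν : Integrable (fun u => min 1 ‖u‖) ν)
    (hG : ∀ n, ContDiff ℝ 1 (G n)) (hK : ∀ n x, ‖G n x‖ ≤ K)
    (hK' : ∀ n x, ‖fderiv ℝ (G n) x‖ ≤ K) (hlim : ∀ x, ∀ᶠ n in atTop, G n =ᶠ[𝓝 x] g) (c : ℝ) :
    Tendsto (fun n => scaledSteinRHS μ ν b₀ α (G n) c) atTop
      (𝓝 (scaledSteinRHS μ ν b₀ α g c)) := by
  have hcont := fun n => (hG n).continuous
  have hcont' := fun n => (hG n).continuous_fderiv one_ne_zero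
  have hdiff := fun n => (hG n).differentiable one_ne_zero
  have hjump : ∀ x, Tendsto (fun n => jumpOperator ν (G n) x) atTop (𝓝 (jumpOperator ν g x)) :=
    fun x => tendsto_integral_of_dominated_convergence (fun u => 2 * K * min 1 ‖u‖)
      (fun n => (integrable_increment hν (hdiff n) (hK n) (hK' n) x).aestronglyMeasurable)
      (hν.const_mul _)
      (fun n => Eventually.of_forall fun u => norm_increment_le (hdiff n) (hK n) (hK' n) x u)
      (Eventually.of_forall fun u => tendsto_const_nhds.congr' (by
        filter_upwards [hlim x, hlim (x + u)] with n h1 h2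
        rw [h1.eq_of_nhds, h2.eq_of_nhds]))
  refine Tendsto.add ?_ (Tendsto.const_smul ?_ _)
  · refine tendsto_integral_of_dominated_convergence (fun _ => K * ‖b₀‖) (fun n => by
      have := hcont' n; fun_prop) (integrable_const _) (fun n => Eventually.of_forall fun x =>
        (fderiv ℝ (G n) (c • x)).le_of_opNorm_le (hK' n _) b₀)
      (Eventually.of_forall fun x => tendsto_const_nhds.congr' ?_)
    filter_upwards [hlim (c • x)] with n h1
    rw [h1.fderiv_eq]
  · exact tendsto_integral_of_dominated_convergence (fun _ => 2 * K * ∫ u, min 1 ‖u‖ ∂ν)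
      (fun n => by
        have := continuous_jumpOperator hν (hdiff n) (hK n) (hK' n); fun_prop)
      (integrable_const _) (fun n => Eventually.of_forall fun x =>
        norm_jumpOperator_le hν (hdiff n) (hK n) (hK' n) _)
      (Eventually.of_forall fun x => hjump _)

theorem integral_scaledSteinRHS_of_tendsto [CompleteSpace F]
    (hν : Integrable (fun u => min 1 ‖u‖) ν) (hα : 0 < α)
    (hG : ∀ n, ContDiff ℝ 1 (G n)) (hK : ∀ n x, ‖G n x‖ ≤ K)
    (hK' : ∀ n x, ‖fderiv ℝ (G n) x‖ ≤ K) (hlim : ∀ x, ∀ᶠ n in atTop, G n =ᶠ[𝓝 x] g)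
    (hr : ∀ n, ∃ R, ∀ x, ‖fderiv ℝ (G n) x x‖ ≤ R)
    (hscal : ∀ c : ℝ, 0 < c → ∀ B : Set E, MeasurableSet B →
      ν (c • B) = ENNReal.ofReal (c ^ (-α)) * ν B)
    (h : ∀ n, ∀ c : ℝ, 0 < c → SteinIdentity μ ν b₀ α fun x => G n (c • x)) {s t : ℝ}
    (hs : 0 < s) (hst : s ≤ t) :
    ∫ c in s..t, scaledSteinRHS μ ν b₀ α g c = ∫ x, g (t • x) ∂μ - ∫ x, g (s • x) ∂μ := by
  have hpos : ∀ c ∈ uIcc s t, 0 < c := fun c hc => by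
    rw [uIcc_of_le hst] at hc
    exact hs.trans_le hc.1
  have hconv : ∀ t : ℝ, Tendsto (fun n => ∫ x, G n (t • x) ∂μ) atTop (𝓝 (∫ x, g (t • x) ∂μ)) := by
    intro t
    refine tendsto_integral_of_dominated_convergence (fun _ => K) (fun n => by
      have := (hG n).continuous; fun_prop) (integrable_const _)
      (fun n => Eventually.of_forall fun x => hK n _)
      (Eventually.of_forall fun x => tendsto_const_nhds.congr' ?_)
    filter_upwards [hlim (t • x)] with n h1
    rw [h1.eq_of_nhds]
  refine tendsto_nhds_unique ?_ (((hconv t).sub (hconv s)).congr fun n =>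
    (integral_scaledSteinRHS hν (hG n) (hK n) (hK' n) (hr n) hscal (h n) hs hst).symm)
  refine intervalIntegral.tendsto_integral_filter_of_dominated_convergence (fun c => K * ‖b₀‖ +
      α * c ^ (α - 1) * (2 * K * ∫ u, min 1 ‖u‖ ∂ν)) (Eventually.of_forall fun n => ?_)
    (Eventually.of_forall fun n => Eventually.of_forall fun c hc => ?_) ?_
    (Eventually.of_forall fun c _ => tendsto_scaledSteinRHS hν hG hK hK' hlim c)
  · exact ((continuousOn_scaledSteinRHS hν (hG n) (hK n) (hK' n)).mono fun c hc =>
      hpos c (uIoc_subset_uIcc hc)).aestronglyMeasurable measurableSet_uIoc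
  · exact norm_scaledSteinRHS_le hν hα.le ((hG n).differentiable one_ne_zero) (hK n) (hK' n)
      (hpos c (uIoc_subset_uIcc hc))
  · exact intervalIntegrable_const.add
      (((intervalIntegral.intervalIntegrable_rpow' (by linarith)).const_mul _).mul_const _)

end Truncation

section Cutoff

variable {E F : Type*} [NormedAddCommGroup E] [InnerProductSpace ℝ E] [FiniteDimensional ℝ E]
  [NormedAddCommGroup F] [NormedSpace ℝ F]

theorem exists_truncation {g : E → F} {K : ℝ} (hg : ContDiff ℝ (⊤ : ℕ∞) g) (hK : ∀ x, ‖g x‖ ≤ K)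
    (hK' : ∀ x, ‖fderiv ℝ g x‖ ≤ K) :
    ∃ (G : ℕ → E → F) (K₁ : ℝ), (∀ n, ContDiff ℝ (⊤ : ℕ∞) (G n)) ∧ (∀ n, HasCompactSupport (G n)) ∧
      (∀ n x, ‖G n x‖ ≤ K₁) ∧ (∀ n x, ‖fderiv ℝ (G n) x‖ ≤ K₁) ∧
      ∀ x, ∀ᶠ n in atTop, G n =ᶠ[𝓝 x] g := by
  let χ : ContDiffBump (0 : E) := ⟨1, 2, one_pos, one_lt_two⟩
  have hχ : ContDiff ℝ (⊤ : ℕ∞) χ := χ.contDiff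
  obtain ⟨C, hC⟩ := (χ.hasCompactSupport.fderiv ℝ).exists_bound_of_continuous
    (hχ.continuous_fderiv (by simp))
  have hK0 : 0 ≤ K := (norm_nonneg _).trans (hK 0)
  have hC0 : 0 ≤ C := (norm_nonneg _).trans (hC 0)
  let a : ℕ → ℝ := fun n => 1 / (n + 1)
  have ha : ∀ n, 0 < a n := fun n => by positivity
  have ha1 : ∀ n, a n ≤ 1 := fun n => by
    simp only [a]
    rw [div_le_one (by positivity)]
    linarith [n.cast_nonneg (α := ℝ)]
  have hχa : ∀ n, ContDiff ℝ (⊤ : ℕ∞) fun x : E => χ (a n • x) := fun n =>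
    hχ.comp (contDiff_const_smul _)
  have hbd : ∀ y : E, ‖χ y‖ ≤ 1 := fun y => by
    rw [Real.norm_of_nonneg χ.nonneg]
    exact χ.le_one
  refine ⟨fun n x => χ (a n • x) • g x, K + C * K, fun n => (hχa n).smul hg, fun n => ?_,
    fun n x => ?_, fun n x => ?_, fun x => ?_⟩
  · exact (χ.hasCompactSupport.comp_smul (ha n).ne').smul_right
  · rw [norm_smul]
    nlinarith [hbd (a n • x), hK x, norm_nonneg (g x), norm_nonneg (χ (a n • x)),
      mul_nonneg hC0 hK0]
  · rw [fderiv_fun_smul ((hχa n).differentiable (by simp) x) (hg.differentiable (by simp) x)]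
    refine (norm_add_le _ _).trans (add_le_add ?_ ?_)
    · rw [norm_smul]
      nlinarith [hbd (a n • x), hK' x, norm_nonneg (fderiv ℝ g x)]
    · have hf : ‖fderiv ℝ (fun x : E => χ (a n • x)) x‖ ≤ C := by
        rw [fderiv_comp_smul, norm_smul, Real.norm_of_nonneg (ha n).le]
        nlinarith [ha1 n, hC (a n • x), norm_nonneg (fderiv ℝ χ (a n • x)), ha n]
      exact (ContinuousLinearMap.norm_smulRight_apply _ _).trans_le
        (mul_le_mul hf (hK x) (norm_nonneg _) hC0)
  · have hlim : Tendsto (fun n => a n * (‖x‖ + 1)) atTop (𝓝 0) := by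
      simpa [a] using tendsto_one_div_add_atTop_nhds_zero_nat.mul_const (‖x‖ + 1)
    filter_upwards [hlim.eventually_lt_const one_pos] with n hn
    filter_upwards [Metric.ball_mem_nhds x one_pos] with y hy
    have hy1 : ‖y‖ ≤ ‖x‖ + 1 := by
      have := norm_le_norm_add_norm_sub' y x
      rw [mem_ball_iff_norm] at hy
      linarith
    have : χ (a n • y) = 1 := by
      refine χ.one_of_mem_closedBall ?_
      rw [mem_closedBall_zero_iff, norm_smul, Real.norm_of_nonneg (ha n).le]
      exact (mul_le_mul_of_nonneg_left hy1 (ha n).le).trans hn.le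
    simp [this]

end Cutoff

section Exponent

variable {E : Type*} [NormedAddCommGroup E] [InnerProductSpace ℝ E]

/-- The character `x ↦ exp (i⟪ξ, x⟫)`. -/
def character (ξ x : E) : ℂ :=
  Complex.exp (Complex.I * ((⟪ξ, x⟫ : ℝ) : ℂ))

theorem norm_character (ξ x : E) : ‖character ξ x‖ = 1 :=
  Complex.norm_exp_I_mul_ofReal _

theorem character_add (ξ x y : E) : character ξ (x + y) = character ξ x * character ξ y := by
  simp [character, inner_add_right, mul_add, Complex.exp_add]

theorem character_smul_left (ξ x : E) (c : ℝ) : character (c • ξ) x = character ξ (c • x) := by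
  simp [character, inner_smul_left, inner_smul_right]

theorem contDiff_character (ξ : E) {n : WithTop ℕ∞} : ContDiff ℝ n (character ξ) := by
  have : ContDiff ℝ n fun x : E => ((⟪ξ, x⟫ : ℝ) : ℂ) :=
    Complex.ofRealCLM.contDiff.comp (contDiff_const.inner ℝ contDiff_id)
  exact (contDiff_const.mul this).cexp

@[fun_prop]
theorem continuous_character : Continuous fun p : E × E => character p.1 p.2 := by
  unfold character
  fun_prop

theorem hasFDerivAt_character (ξ x : E) : HasFDerivAt (character ξ)
    ((character ξ x * Complex.I) • Complex.ofRealCLM.comp (innerSL ℝ ξ)) x := by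
  have h : HasFDerivAt (fun x : E => Complex.I * ((⟪ξ, x⟫ : ℝ) : ℂ))
      (Complex.I • Complex.ofRealCLM.comp (innerSL ℝ ξ)) x :=
    ((Complex.ofRealCLM.comp (innerSL ℝ ξ)).hasFDerivAt (x := x)).const_mul Complex.I
  refine h.cexp.congr_fderiv ?_
  ext v
  simp [character, mul_assoc]

theorem fderiv_character_apply (ξ x v : E) :
    fderiv ℝ (character ξ) x v = character ξ x * (Complex.I * ((⟪ξ, v⟫ : ℝ) : ℂ)) := by
  simp [(hasFDerivAt_character ξ x).fderiv, mul_assoc]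

theorem norm_fderiv_character_le (ξ x : E) : ‖fderiv ℝ (character ξ) x‖ ≤ ‖ξ‖ := by
  refine ContinuousLinearMap.opNorm_le_bound _ (norm_nonneg _) fun v => ?_
  rw [fderiv_character_apply, norm_mul, norm_character, norm_mul, Complex.norm_I,
    Complex.norm_real, one_mul, one_mul]
  exact norm_inner_le_norm _ _

theorem norm_character_sub_one_le (ξ u : E) :
    ‖character ξ u - 1‖ ≤ 2 * (1 + ‖ξ‖) * min 1 ‖u‖ := by
  have := norm_increment_le (g := character ξ) (K := 1 + ‖ξ‖)
    ((contDiff_character ξ (n := 1)).differentiable one_ne_zero)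
    (fun x => by rw [norm_character]; linarith [norm_nonneg ξ])
    (fun x => (norm_fderiv_character_le ξ x).trans (by linarith)) 0 u
  simpa [character] using this

variable [MeasurableSpace E] {μ ν : Measure E} {α : ℝ}

/-- The jump part of the Lévy–Khintchine exponent. -/
def jumpExponent (ν : Measure E) (ξ : E) : ℂ :=
  ∫ u, (character ξ u - 1) ∂ν

theorem norm_jumpExponent_le (hν : Integrable (fun u => min 1 ‖u‖) ν) (ξ : E) :
    ‖jumpExponent ν ξ‖ ≤ 2 * (1 + ‖ξ‖) * ∫ u, min 1 ‖u‖ ∂ν := by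
  rw [← integral_const_mul]
  exact norm_integral_le_of_norm_le (hν.const_mul _)
    (Eventually.of_forall fun u => norm_character_sub_one_le ξ u)

theorem jumpExponent_smul [BorelSpace E]
    (hscal : ∀ c : ℝ, 0 < c → ∀ B : Set E, MeasurableSet B →
      ν (c • B) = ENNReal.ofReal (c ^ (-α)) * ν B) {c : ℝ} (hc : 0 < c) (ξ : E) :
    jumpExponent ν (c • ξ) = (c ^ α : ℝ) * jumpExponent ν ξ := by
  simp only [jumpExponent, character_smul_left]
  rw [integral_comp_smul_of_scaling hscal hc fun u => character ξ u - 1, Complex.real_smul]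

theorem jumpOperator_character (ξ x : E) :
    jumpOperator ν (character ξ) x = character ξ x * jumpExponent ν ξ := by
  rw [jumpOperator, jumpExponent, ← integral_const_mul]
  simp only [character_add, mul_sub, mul_one]

theorem charFun_eq_integral_character (ξ : E) : charFun μ ξ = ∫ x, character ξ x ∂μ := by
  simp only [charFun_apply, character, real_inner_comm, mul_comm]

theorem charFun_smul_eq_integral_character (c : ℝ) (ξ : E) :
    charFun μ (c • ξ) = ∫ x, character ξ (c • x) ∂μ := by
  simp only [charFun_eq_integral_character, character_smul_left]

theorem scaledSteinRHS_character
    (b₀ ξ : E) (c : ℝ) :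
    scaledSteinRHS μ ν b₀ α (character ξ) c = charFun μ (c • ξ) *
      (Complex.I * ((⟪ξ, b₀⟫ : ℝ) : ℂ) + (α * c ^ (α - 1) : ℝ) * jumpExponent ν ξ) := by
  simp only [scaledSteinRHS, fderiv_character_apply, jumpOperator_character, integral_mul_const,
    ← charFun_smul_eq_integral_character, Complex.real_smul]
  ring

/-- The Lévy–Khintchine exponent along the ray through `ξ`. -/
def rayExponent (ν : Measure E) (b₀ : E) (α : ℝ) (ξ : E) (c : ℝ) : ℂ :=
  Complex.I * ((⟪ξ, b₀⟫ : ℝ) : ℂ) * c + (c ^ α : ℝ) * jumpExponent ν ξ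

theorem hasDerivAt_rayExponent (b₀ ξ : E) {c : ℝ} (hc : 0 < c) :
    HasDerivAt (rayExponent ν b₀ α ξ)
      (Complex.I * ((⟪ξ, b₀⟫ : ℝ) : ℂ) + (α * c ^ (α - 1) : ℝ) * jumpExponent ν ξ) c := by
  have h1 : HasDerivAt (fun c : ℝ => (c : ℂ)) 1 c := Complex.ofRealCLM.hasDerivAt
  have h2 := (Real.hasDerivAt_rpow_const (p := α) (Or.inl hc.ne')).ofReal_comp
  exact ((h1.const_mul (Complex.I * ((⟪ξ, b₀⟫ : ℝ) : ℂ))).add (h2.mul_const _)).congr_deriv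
    (by rw [mul_one])

theorem continuous_rayExponent (hα : 0 < α) (b₀ ξ : E) :
    Continuous (rayExponent ν b₀ α ξ) := by
  have := Real.continuous_rpow_const hα.le
  unfold rayExponent
  fun_prop

end Exponent

section CharacteristicFunction

variable {E : Type*} [NormedAddCommGroup E] [InnerProductSpace ℝ E]
  [MeasurableSpace E] [BorelSpace E] {μ ν : Measure E} [IsProbabilityMeasure μ] {α : ℝ} {b₀ : E}

/-- The Stein identity for test functions determines the characteristic function. -/
theorem charFun_eq_exp_of_steinIdentity [FiniteDimensional ℝ E]
    (hν : Integrable (fun u => min 1 ‖u‖) ν) (hα : 0 < α)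
    (hscal : ∀ c : ℝ, 0 < c → ∀ B : Set E, MeasurableSet B →
      ν (c • B) = ENNReal.ofReal (c ^ (-α)) * ν B)
    (h : ∀ g : E → ℂ, ContDiff ℝ (⊤ : ℕ∞) g → HasCompactSupport g → SteinIdentity μ ν b₀ α g)
    (ξ : E) :
    charFun μ ξ = Complex.exp (Complex.I * ((⟪ξ, b₀⟫ : ℝ) : ℂ) + jumpExponent ν ξ) := by
  have hK : ∀ x, ‖character ξ x‖ ≤ 1 + ‖ξ‖ := fun x => by
    rw [norm_character]; linarith [norm_nonneg ξ]
  have hK' : ∀ x, ‖fderiv ℝ (character ξ) x‖ ≤ 1 + ‖ξ‖ := fun x =>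
    (norm_fderiv_character_le ξ x).trans (by linarith)
  obtain ⟨G, K₁, hG, hGc, hGK, hGK', hlim⟩ := exists_truncation (contDiff_character ξ) hK hK'
  have hle : (1 : WithTop ℕ∞) ≤ ((⊤ : ℕ∞) : WithTop ℕ∞) := by simp
  have hint : ∀ s t : ℝ, 0 < s → s ≤ t →
      ∫ c in s..t, scaledSteinRHS μ ν b₀ α (character ξ) c =
        charFun μ (t • ξ) - charFun μ (s • ξ) := fun s t hs hst => by
    simp only [charFun_smul_eq_integral_character]
    refine integral_scaledSteinRHS_of_tendsto hν hα (fun n => (hG n).of_le hle) hGK hGK' hlim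
      (fun n => ?_) hscal (fun n c hc => h _ ((hG n).comp (contDiff_const_smul c))
        ((hGc n).comp_smul hc.ne')) hs hst
    have hcs : HasCompactSupport fun x => fderiv ℝ (G n) x x :=
      ((hGc n).fderiv ℝ).mono fun x hx => by
        contrapose! hx
        simp_all
    have := (hG n).continuous_fderiv (by simp)
    exact hcs.exists_bound_of_continuous (by fun_prop)
  have hcont := continuousOn_scaledSteinRHS (μ := μ) (b₀ := b₀) (α := α) hν
    (contDiff_character ξ) hK hK'
  have hderiv : ∀ t : ℝ, 0 < t → HasDerivAt (fun t : ℝ => charFun μ (t • ξ))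
      (scaledSteinRHS μ ν b₀ α (character ξ) t) t := fun t ht => by
    have hsub : uIcc (t / 2) t ⊆ Ioi 0 := fun c hc => by
      rw [uIcc_of_le (by linarith)] at hc
      exact (half_pos ht).trans_le hc.1
    have h1 := intervalIntegral.integral_hasDerivAt_right (hcont.mono hsub).intervalIntegrable
      (hcont.stronglyMeasurableAtFilter isOpen_Ioi t ht) (hcont.continuousAt (Ioi_mem_nhds ht))
    refine (h1.add_const (charFun μ ((t / 2) • ξ))).congr_of_eventuallyEq ?_
    filter_upwards [Ioi_mem_nhds (half_lt_self ht)] with s hs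
    rw [hint _ _ (half_pos ht) (mem_Ioi.mp hs).le, sub_add_cancel]
  have hconst := intervalIntegral.integral_eq_sub_of_hasDerivAt_of_le zero_le_one
    (f := fun c : ℝ => charFun μ (c • ξ) * Complex.exp (-rayExponent ν b₀ α ξ c))
    (f' := fun _ => 0) (by
      have := continuous_rayExponent (ν := ν) hα b₀ ξ
      have := continuous_charFun (μ := μ)
      fun_prop)
    (fun c hc => by
      refine ((hderiv c hc.1).mul (hasDerivAt_rayExponent b₀ ξ hc.1).neg.cexp).congr_deriv ?_
      rw [scaledSteinRHS_character]
      ring) (by simp)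
  simp only [intervalIntegral.integral_zero, one_smul, zero_smul, rayExponent,
    Real.zero_rpow hα.ne', Real.one_rpow, charFun_zero] at hconst
  simp only [Complex.ofReal_one, mul_one, one_mul, probReal_univ, Complex.ofReal_zero, mul_zero,
    zero_mul, add_zero, neg_zero, Complex.exp_zero] at hconst
  rw [Complex.exp_neg, eq_comm, sub_eq_zero, mul_inv_eq_one₀ (Complex.exp_ne_zero _)] at hconst
  exact hconst

theorem measurable_jumpExponent [SecondCountableTopology E] [SFinite ν] :
    Measurable (jumpExponent ν) := by
  have : StronglyMeasurable (Function.uncurry fun ξ u : E => character ξ u - 1) :=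
    (continuous_character.sub continuous_const).stronglyMeasurable
  exact this.integral_prod_right.measurable

variable {Ω : Type*} [MeasurableSpace Ω] {m : Measure Ω} [SFinite m] {k : Ω → E} {F : Ω → ℂ}

theorem integral_integral_character_mul [SecondCountableTopology E] (hk : Measurable k)
    (hF : Integrable F m) (c : ℝ) :
    ∫ x, ∫ ω, character (k ω) (c • x) * F ω ∂m ∂μ = ∫ ω, charFun μ (c • k ω) * F ω ∂m := by
  rw [integral_integral_swap]
  · simp only [integral_mul_const, charFun_smul_eq_integral_character]
  · refine (hF.comp_snd μ).norm.mono' ?_ (Eventually.of_forall fun p => ?_)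
    · refine AEStronglyMeasurable.mul ?_ (hF.comp_snd μ).aestronglyMeasurable
      exact (continuous_character.measurable.comp
        ((hk.comp measurable_snd).prodMk (measurable_fst.const_smul c))).aestronglyMeasurable
    · simp [Function.uncurry, norm_character]

/-- The Stein identity for superpositions of characters. -/
theorem steinIdentity_of_charFun_eq_exp [SecondCountableTopology E] [SFinite ν]
    (hν : Integrable (fun u => min 1 ‖u‖) ν) (hα : α ∈ Ioo (0 : ℝ) 1)
    (hscal : ∀ c : ℝ, 0 < c → ∀ B : Set E, MeasurableSet B →
      ν (c • B) = ENNReal.ofReal (c ^ (-α)) * ν B)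
    (hφ : ∀ ξ, charFun μ ξ =
      Complex.exp (Complex.I * ((⟪ξ, b₀⟫ : ℝ) : ℂ) + jumpExponent ν ξ))
    {f : E → ℂ} {K : ℝ} (hf : ContDiff ℝ 1 f) (hK : ∀ x, ‖f x‖ ≤ K)
    (hr : ∀ x, ‖fderiv ℝ f x x‖ ≤ K) (hk : Measurable k) (hF : Integrable F m)
    (hkF : Integrable (fun ω => ‖k ω‖ * ‖F ω‖) m)
    (hrep : ∀ x, f x = ∫ ω, character (k ω) x * F ω ∂m) :
    SteinIdentity μ ν b₀ α f := by
  set C := ∫ u, min 1 ‖u‖ ∂ν with hC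
  have hC0 : 0 ≤ C := integral_nonneg fun u => by positivity
  have hchar : ∀ x, AEStronglyMeasurable (fun ω => character (k ω) x) m := fun x =>
    (continuous_character.measurable.comp (hk.prodMk measurable_const)).aestronglyMeasurable
  have hinner : ∀ v : E, AEStronglyMeasurable
      (fun ω => Complex.I * ((⟪k ω, v⟫ : ℝ) : ℂ) * F ω) m := fun v => by
    have := hF.aestronglyMeasurable
    fun_prop
  have hinner_int : ∀ v : E, Integrable (fun ω => Complex.I * ((⟪k ω, v⟫ : ℝ) : ℂ) * F ω) m :=
    fun v => (hkF.mul_const ‖v‖).mono' (hinner v) (Eventually.of_forall fun ω => by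
      rw [norm_mul, norm_mul, Complex.norm_I, Complex.norm_real, one_mul, mul_right_comm]
      exact mul_le_mul_of_nonneg_right (norm_inner_le_norm _ _) (norm_nonneg _))
  have hwt_int : Integrable (fun ω => 2 * (1 + ‖k ω‖) * ‖F ω‖) m := by
    refine ((hF.norm.add hkF).const_mul 2).congr (Eventually.of_forall fun ω => ?_)
    simp only [Pi.add_apply]
    ring
  have hjump_meas : AEStronglyMeasurable (fun ω => jumpExponent ν (k ω) * F ω) m :=
    (measurable_jumpExponent.comp hk).aestronglyMeasurable.mul hF.aestronglyMeasurable
  have hjump_int : Integrable (fun ω => jumpExponent ν (k ω) * F ω) m :=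
    (hwt_int.mul_const C).mono' hjump_meas (Eventually.of_forall fun ω => by
      rw [norm_mul, mul_right_comm]
      exact mul_le_mul_of_nonneg_right (norm_jumpExponent_le hν _) (norm_nonneg _))
  have hfderiv : ∀ x v, fderiv ℝ f x v =
      ∫ ω, character (k ω) x * (Complex.I * ((⟪k ω, v⟫ : ℝ) : ℂ) * F ω) ∂m := fun x v => by
    have hline : ∀ t : ℝ, HasDerivAt (fun t : ℝ => x + t • v) v t := fun t => by
      simpa using ((hasDerivAt_id t).smul_const v).const_add x
    have h1 : HasDerivAt (fun t : ℝ => f (x + t • v)) (fderiv ℝ f x v) 0 := by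
      have h := (hf.differentiable one_ne_zero (x + (0 : ℝ) • v)).hasFDerivAt.comp_hasDerivAt
        (0 : ℝ) (hline 0)
      rwa [zero_smul, add_zero] at h
    have h2 := (hasDerivAt_integral_of_dominated_loc_of_deriv_le (μ := m) (x₀ := (0 : ℝ))
      (F := fun t ω => character (k ω) (x + t • v) * F ω)
      (F' := fun t ω => character (k ω) (x + t • v) * (Complex.I * ((⟪k ω, v⟫ : ℝ) : ℂ) * F ω))
      (bound := fun ω => ‖Complex.I * ((⟪k ω, v⟫ : ℝ) : ℂ) * F ω‖)
      univ_mem (Eventually.of_forall fun t => (hchar _).mul hF.aestronglyMeasurable)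
      (hF.norm.mono' ((hchar _).mul hF.aestronglyMeasurable)
        (Eventually.of_forall fun ω => by rw [norm_mul, norm_character, one_mul]))
      ((hchar _).mul (hinner v))
      (Eventually.of_forall fun ω t _ => by rw [norm_mul, norm_character, one_mul])
      (hinner_int v).norm (Eventually.of_forall fun ω t _ => by
        have h := ((hasFDerivAt_character (k ω) (x + t • v)).differentiableAt.hasFDerivAt
          |>.comp_hasDerivAt t (hline t)).mul_const (F ω)
        rw [fderiv_character_apply, mul_assoc] at h
        exact h)).2
    simp only [← hrep, zero_smul, add_zero] at h2
    exact h1.unique h2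
  have hjump : ∀ x, jumpOperator ν f x =
      ∫ ω, character (k ω) x * (jumpExponent ν (k ω) * F ω) ∂m := fun x => by
    have hchar_int : ∀ y, Integrable (fun ω => character (k ω) y * F ω) m := fun y =>
      hF.norm.mono' ((hchar y).mul hF.aestronglyMeasurable)
        (Eventually.of_forall fun ω => by rw [norm_mul, norm_character, one_mul])
    have hsub : ∀ u, f (x + u) - f x = ∫ ω, character (k ω) x * ((character (k ω) u - 1) * F ω) ∂m :=
      fun u => by
        rw [hrep, hrep, ← integral_sub (hchar_int _) (hchar_int _)]
        congr 1 with ω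
        rw [character_add]
        ring
    simp only [jumpOperator, hsub]
    rw [integral_integral_swap]
    · simp only [integral_const_mul, integral_mul_const, jumpExponent]
    · refine (hν.mul_prod hwt_int).mono' ?_ (Eventually.of_forall fun p => ?_)
      · have hm1 : Measurable fun p : E × Ω => character (k p.2) x :=
          continuous_character.measurable.comp ((hk.comp measurable_snd).prodMk measurable_const)
        have hm2 : Measurable fun p : E × Ω => character (k p.2) p.1 :=
          continuous_character.measurable.comp ((hk.comp measurable_snd).prodMk measurable_fst)
        exact hm1.aestronglyMeasurable.mul ((hm2.sub_const 1).aestronglyMeasurable.mul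
          hF.aestronglyMeasurable.comp_snd)
      · simp only [Function.uncurry, norm_mul, norm_character, one_mul]
        rw [← mul_assoc, mul_comm (min 1 ‖p.1‖)]
        exact mul_le_mul_of_nonneg_right (norm_character_sub_one_le _ _) (norm_nonneg _)
  have hray : ∀ ξ (c : ℝ), 0 < c → charFun μ (c • ξ) = Complex.exp (rayExponent ν b₀ α ξ c) :=
    fun ξ c hc => by
      rw [hφ, jumpExponent_smul hscal hc, rayExponent, real_inner_smul_left]
      push_cast
      ring_nf
  have hcharFun : ∀ c : ℝ, AEStronglyMeasurable (fun ω => charFun μ (c • k ω)) m := fun c =>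
    (continuous_charFun.measurable.comp (hk.const_smul c)).aestronglyMeasurable
  have hpow : ∀ c ∈ Ioi (1 / 2 : ℝ), c ^ (α - 1) ≤ (1 / 2) ^ (α - 1) := fun c hc =>
    Real.rpow_le_rpow_of_nonpos (by norm_num) (mem_Ioi.mp hc).le (by linarith [hα.2])
  have hderiv := (hasDerivAt_integral_of_dominated_loc_of_deriv_le (μ := m) (x₀ := (1 : ℝ))
    (F := fun c ω => charFun μ (c • k ω) * F ω)
    (F' := fun c ω => charFun μ (c • k ω) * (Complex.I * ((⟪k ω, b₀⟫ : ℝ) : ℂ) * F ω +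
      (α * c ^ (α - 1) : ℝ) * (jumpExponent ν (k ω) * F ω)))
    (bound := fun ω => ‖Complex.I * ((⟪k ω, b₀⟫ : ℝ) : ℂ) * F ω‖ +
      α * (1 / 2) ^ (α - 1) * ‖jumpExponent ν (k ω) * F ω‖)
    (Ioi_mem_nhds (show (1 / 2 : ℝ) < 1 by norm_num))
    (Eventually.of_forall fun c => (hcharFun c).mul hF.aestronglyMeasurable)
    (hF.norm.mono' ((hcharFun 1).mul hF.aestronglyMeasurable) (Eventually.of_forall fun ω => by
      rw [norm_mul]
      exact mul_le_of_le_one_left (norm_nonneg _) (norm_charFun_le_one _)))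
    ((hcharFun 1).mul ((hinner b₀).add (hjump_meas.const_mul _)))
    (Eventually.of_forall fun ω c hc => by
      rw [norm_mul]
      refine (mul_le_of_le_one_left (norm_nonneg _) (norm_charFun_le_one _)).trans ?_
      refine (norm_add_le _ _).trans (add_le_add_right ?_ _)
      have hc0 : 0 < c := lt_trans (by norm_num) (mem_Ioi.mp hc)
      rw [norm_mul, Complex.norm_real,
        Real.norm_of_nonneg (mul_nonneg hα.1.le (Real.rpow_nonneg hc0.le _))]
      exact mul_le_mul_of_nonneg_right (mul_le_mul_of_nonneg_left (hpow c hc) hα.1.le)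
        (norm_nonneg _))
    ((hinner_int b₀).norm.add (hjump_int.norm.const_mul _))
    (Eventually.of_forall fun ω c hc => by
      have hc0 : 0 < c := lt_trans (by norm_num) (mem_Ioi.mp hc)
      have h := (hasDerivAt_rayExponent (ν := ν) (α := α) b₀ (k ω) hc0).cexp.mul_const (F ω)
      rw [← hray _ _ hc0] at h
      refine (h.congr_of_eventuallyEq ?_).congr_deriv (by ring)
      filter_upwards [Ioi_mem_nhds hc0] with s hs
      rw [hray _ _ hs])).2
  have hlhs : ∫ x, fderiv ℝ f x x ∂μ = ∫ ω, charFun μ (k ω) *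
      (Complex.I * ((⟪k ω, b₀⟫ : ℝ) : ℂ) * F ω + α * (jumpExponent ν (k ω) * F ω)) ∂m := by
    have h := hasDerivAt_integral_comp_smul (μ := μ) hf hK hr one_pos
    simp only [hrep, integral_integral_character_mul hk hF] at h
    simpa [← hrep] using h.unique hderiv
  have hA : ∀ {G : Ω → ℂ}, Integrable G m →
      ∫ x, ∫ ω, character (k ω) x * G ω ∂m ∂μ = ∫ ω, charFun μ (k ω) * G ω ∂m := fun hG => by
    simpa using integral_integral_character_mul (μ := μ) hk hG 1
  have hmul_int : ∀ {G : Ω → ℂ}, Integrable G m → Integrable (fun ω => charFun μ (k ω) * G ω) m :=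
    fun hG => hG.norm.mono' ((by simpa using hcharFun 1 :
        AEStronglyMeasurable (fun ω => charFun μ (k ω)) m).mul hG.aestronglyMeasurable)
      (Eventually.of_forall fun ω => by
        rw [norm_mul]
        exact mul_le_of_le_one_left (norm_nonneg _) (norm_charFun_le_one _))
  simp only [SteinIdentity, hjump]
  rw [hlhs]
  simp only [hfderiv]
  rw [hA (hinner_int b₀), hA hjump_int, Complex.real_smul, ← integral_const_mul,
    ← integral_add (hmul_int (hinner_int b₀)) ((hmul_int hjump_int).const_mul _)]
  congr 1 with ω
  ring

end CharacteristicFunction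

section Schwartz

variable {E F : Type*} [NormedAddCommGroup E] [NormedSpace ℝ E] [NormedAddCommGroup F]
  [NormedSpace ℝ F]

theorem SchwartzMap.exists_bounds (f : SchwartzMap E F) :
    ∃ K, (∀ x, ‖f x‖ ≤ K) ∧ (∀ x, ‖fderiv ℝ f x‖ ≤ K) ∧ ∀ x, ‖fderiv ℝ f x x‖ ≤ K := by
  obtain ⟨C₀, -, h₀⟩ := f.decay 0 0
  obtain ⟨C₁, -, h₁⟩ := f.decay 0 1
  obtain ⟨C₂, -, h₂⟩ := f.decay 1 1
  simp only [pow_zero, pow_one, one_mul, norm_iteratedFDeriv_zero, norm_iteratedFDeriv_one]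
    at h₀ h₁ h₂
  refine ⟨max C₀ (max C₁ C₂), fun x => (h₀ x).trans (le_max_left _ _),
    fun x => (h₁ x).trans ((le_max_left _ _).trans (le_max_right _ _)), fun x => ?_⟩
  refine ((fderiv ℝ f x).le_opNorm x).trans ?_
  rw [mul_comm]
  exact (h₂ x).trans ((le_max_right _ _).trans (le_max_right _ _))

end Schwartz

section ScalarTransfer

variable {E F G : Type*} [NormedAddCommGroup E] [NormedSpace ℝ E] [MeasurableSpace E]
  [BorelSpace E] [SecondCountableTopology E] [NormedAddCommGroup F] [NormedSpace ℝ F]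
  [CompleteSpace F] [NormedAddCommGroup G] [NormedSpace ℝ G] [CompleteSpace G] {μ ν : Measure E}
  [IsProbabilityMeasure μ] {α : ℝ} {b₀ : E}

theorem steinIdentity_clm_comp_iff (hν : Integrable (fun u => min 1 ‖u‖) ν) (T : F →L[ℝ] G)
    {g : E → F} {K : ℝ} (hg : ContDiff ℝ 1 g) (hK : ∀ x, ‖g x‖ ≤ K)
    (hK' : ∀ x, ‖fderiv ℝ g x‖ ≤ K) (hr : ∀ x, ‖fderiv ℝ g x x‖ ≤ K) :
    SteinIdentity μ ν b₀ α (fun x => T (g x)) ↔ T (∫ x, fderiv ℝ g x x ∂μ) =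
      T (∫ x, fderiv ℝ g x b₀ ∂μ + α • ∫ x, jumpOperator ν g x ∂μ) := by
  have hd := hg.differentiable one_ne_zero
  have hcont := hg.continuous_fderiv one_ne_zero
  have hfd : ∀ x v, fderiv ℝ (fun x => T (g x)) x v = T (fderiv ℝ g x v) := fun x v => by
    have h : HasFDerivAt (fun x => T (g x)) (T.comp (fderiv ℝ g x)) x :=
      T.hasFDerivAt.comp x (hd x).hasFDerivAt
    rw [h.fderiv]
    rfl
  have hj : ∀ x, jumpOperator ν (fun x => T (g x)) x = T (jumpOperator ν g x) := fun x => by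
    simp only [jumpOperator, ← map_sub]
    exact T.integral_comp_comm (integrable_increment hν hd hK hK' x)
  have hint : Integrable (fun x => fderiv ℝ g x x) μ :=
    .of_bound (by fun_prop) K (Eventually.of_forall hr)
  simp only [SteinIdentity, hfd, hj]
  rw [T.integral_comp_comm hint, T.integral_comp_comm (integrable_fderiv_apply hg hK' b₀),
    T.integral_comp_comm (integrable_jumpOperator hν hd hK hK'), map_add, map_smul]

theorem steinIdentity_complex_iff_real (hν : Integrable (fun u => min 1 ‖u‖) ν) :
    (∀ f : SchwartzMap E ℂ, SteinIdentity μ ν b₀ α f) ↔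
      ∀ f : SchwartzMap E ℝ, SteinIdentity μ ν b₀ α f := by
  constructor
  · intro h f
    let f' : SchwartzMap E ℂ := f.postcompCLM Complex.ofRealCLM
    obtain ⟨K, hK, hK', hr⟩ := f'.exists_bounds
    have := (steinIdentity_clm_comp_iff hν Complex.reCLM (f'.smooth 1) hK hK' hr).mpr
      (congrArg _ (h f'))
    exact this
  · intro h f
    obtain ⟨K, hK, hK', hr⟩ := f.exists_bounds
    exact Complex.ext
      ((steinIdentity_clm_comp_iff hν Complex.reCLM (f.smooth 1) hK hK' hr).mp
        (h (f.postcompCLM Complex.reCLM)))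
      ((steinIdentity_clm_comp_iff hν Complex.imCLM (f.smooth 1) hK hK' hr).mp
        (h (f.postcompCLM Complex.imCLM)))

end ScalarTransfer

theorem inner_gradient_eq_fderiv {E : Type*} [NormedAddCommGroup E] [InnerProductSpace ℝ E]
    [CompleteSpace E] (f : E → ℝ) (x v : E) :
    ⟪v, gradient f x⟫ = fderiv ℝ f x v := by
  rw [real_inner_comm, ← toDual_gradient, InnerProductSpace.toDual_apply_apply]

section Main

variable {E : Type*} [NormedAddCommGroup E] [InnerProductSpace ℝ E] [FiniteDimensional ℝ E]
  [MeasurableSpace E] [BorelSpace E] {μ ν : Measure E} [IsProbabilityMeasure μ] {α : ℝ} {b₀ : E}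

open FourierTransform in
theorem SchwartzMap.eq_integral_character (f : SchwartzMap E ℂ) (x : E) :
    f x = ∫ ξ : E, character ((2 * Real.pi) • ξ) x * (𝓕 f : SchwartzMap E ℂ) ξ := by
  have h : f x = 𝓕⁻ (⇑(𝓕 f : SchwartzMap E ℂ)) x := by
    rw [← SchwartzMap.fourierInv_coe, FourierTransform.fourierInv_fourier_eq]
  rw [h, Real.fourierInv_eq']
  congr 1 with ξ
  rw [character, real_inner_smul_left, smul_eq_mul, mul_comm Complex.I]

open FourierTransform in
theorem forall_steinIdentity_iff_charFun [SFinite ν]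
    (hν : Integrable (fun u => min 1 ‖u‖) ν) (hα : α ∈ Ioo (0 : ℝ) 1)
    (hscal : ∀ c : ℝ, 0 < c → ∀ B : Set E, MeasurableSet B →
      ν (c • B) = ENNReal.ofReal (c ^ (-α)) * ν B) :
    (∀ f : SchwartzMap E ℂ, SteinIdentity μ ν b₀ α f) ↔ ∀ ξ, charFun μ ξ =
      Complex.exp (Complex.I * ((⟪ξ, b₀⟫ : ℝ) : ℂ) + jumpExponent ν ξ) := by
  constructor
  · exact fun h => charFun_eq_exp_of_steinIdentity hν hα.1 hscal fun g hg hgc =>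
      h (hgc.toSchwartzMap hg)
  · intro hφ f
    obtain ⟨K, hK, -, hr⟩ := f.exists_bounds
    refine steinIdentity_of_charFun_eq_exp hν hα hscal hφ (f.smooth 1) hK hr
      (measurable_const_smul (2 * Real.pi)) (𝓕 f : SchwartzMap E ℂ).integrable ?_ f.eq_integral_character
    refine (((𝓕 f : SchwartzMap E ℂ).integrable_pow_mul volume 1).const_mul ‖2 * Real.pi‖).congr
      (Eventually.of_forall fun ξ => ?_)
    simp only [norm_smul, pow_one, mul_assoc]

theorem inner_integral_gradient (f : SchwartzMap E ℝ) (v : E) :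
    ⟪v, ∫ x, gradient f x ∂μ⟫ = ∫ x, fderiv ℝ f x v ∂μ := by
  obtain ⟨K, -, hK', -⟩ := f.exists_bounds
  have hcont := (f.smooth 1).continuous_fderiv one_ne_zero
  have hint : Integrable (fun x => fderiv ℝ f x) μ :=
    .of_bound hcont.aestronglyMeasurable K (Eventually.of_forall hK')
  have hgrad : Integrable (gradient f) μ :=
    (InnerProductSpace.toDual ℝ E).symm.toContinuousLinearEquiv.toContinuousLinearMap
      |>.integrable_comp hint
  rw [← integral_inner hgrad]
  simp only [inner_gradient_eq_fderiv]

end Main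

/-- Characterization of `α`-stable random vectors, `α ∈ (0,1)`, via a Stein-type identity
(Theorem 3.1 / `thm:caracSteinStable2`). -/
theorem stmt1 {d : ℕ} (μ ν : Measure (EuclideanSpace ℝ (Fin d)))
    [IsProbabilityMeasure μ] (b : EuclideanSpace ℝ (Fin d))
    (α : ℝ) (hα : α ∈ Set.Ioo (0 : ℝ) 1)
    (hLevy : IsLevyMeasure ν)
    (hscal : ∀ c : ℝ, 0 < c → ∀ B : Set (EuclideanSpace ℝ (Fin d)), MeasurableSet B →
      ν (c • B) = ENNReal.ofReal (c ^ (-α)) * ν B) :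
    (∀ f : SchwartzMap (EuclideanSpace ℝ (Fin d)) ℝ,
        ∫ x, ⟪x, gradient (⇑f) x⟫ ∂μ
          = ⟪b - ∫ u in {u : EuclideanSpace ℝ (Fin d) | ‖u‖ ≤ 1}, u ∂ν,
              ∫ x, gradient (⇑f) x ∂μ⟫
            + α * ∫ x, ∫ u, (f (x + u) - f x) ∂ν ∂μ)
      ↔ (∀ ξ, charFn μ ξ
          = Complex.exp
              (Complex.I *
                  ((⟪ξ, b - ∫ u in {u : EuclideanSpace ℝ (Fin d) | ‖u‖ ≤ 1}, u ∂ν⟫ : ℝ) : ℂ)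
                + ∫ u, (Complex.exp (Complex.I * ((⟪ξ, u⟫ : ℝ) : ℂ)) - 1) ∂ν)) := by
  have hν : Integrable (fun u => min 1 ‖u‖) ν := integrable_min_one_norm hα hLevy.2 hscal
  have : SigmaFinite ν := sigmaFinite_of_lintegral_min_one_sq_lt_top hLevy.1 hLevy.2
  have hchar : ∀ ξ, charFn μ ξ = charFun μ ξ := fun ξ => (charFun_eq_integral_character ξ).symm
  simp only [hchar, inner_gradient_eq_fderiv, inner_integral_gradient]
  exact (steinIdentity_complex_iff_real hν).symm.trans
    (forall_steinIdentity_iff_charFun hν hα hscal)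
end
end
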